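/- Let n ∈ ℕ and let (K,v) be an equicharacteristic henselian valued field whose residue field Kv is large, and assume v is trivial on a subfield C of K. Identify C with its image in Kv under the residue map, and assume the extension Kv/C is separable. If (R4_n) holds, then Th_{∃_n}(K,C) = Th_{∃_n}(Kv,C) (as L_ring(C)-theories). -/

import Mathlib

open FirstOrder FirstOrder.Language

universe u v w x

namespace Paper



/-! ### Syntactic fragments -/

/-- `IsExistsN n φ`: `φ` is an `∃_n`-formula, i.e. of the form `∃ x₁ … x_m ψ`
with `m ≤ n` and `ψ` quantifier-free. -/
inductive IsExistsN {L : Language} {α : Type*} : ℕ → ∀ {k : ℕ}, L.BoundedFormula α k → Prop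
  | qf {n k : ℕ} {φ : L.BoundedFormula α k} : φ.IsQF → IsExistsN n φ
  | ex {n k : ℕ} {φ : L.BoundedFormula α (k + 1)} : IsExistsN n φ → IsExistsN (n + 1) φ.ex

/-- `φ` is an existential formula. -/
def IsExists {L : Language} {α : Type*} {k : ℕ} (φ : L.BoundedFormula α k) : Prop :=
  ∃ n : ℕ, IsExistsN n φ

/-- Positive boolean combinations of formulas satisfying `P`. -/
inductive IsPosBC {L : Language} {α : Type*} (P : ∀ {k : ℕ}, L.BoundedFormula α k → Prop) :
    ∀ {k : ℕ}, L.BoundedFormula α k → Prop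
  | base {k : ℕ} {φ : L.BoundedFormula α k} : P φ → IsPosBC P φ
  | inf {k : ℕ} {φ ψ : L.BoundedFormula α k} :
      IsPosBC P φ → IsPosBC P ψ → IsPosBC P (φ ⊓ ψ)
  | sup {k : ℕ} {φ ψ : L.BoundedFormula α k} :
      IsPosBC P φ → IsPosBC P ψ → IsPosBC P (φ ⊔ ψ)

/-- The `∃₁`-fragment: positive boolean combinations of formulas of the form `η` or `∃ y η`
with `η` quantifier-free. -/
def IsE1 {L : Language} {α : Type*} {k : ℕ} (φ : L.BoundedFormula α k) : Prop :=
  IsPosBC (fun {k} φ => φ.IsQF ∨ ∃ ψ : L.BoundedFormula α (k + 1), ψ.IsQF ∧ φ = ψ.ex) φ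

/-- `∃_n∃₁`-formulas: `∃ x₁ … x_m ψ` with `m ≤ n` and `ψ` in the `∃₁`-fragment. -/
inductive IsExistsNE1 {L : Language} {α : Type*} : ℕ → ∀ {k : ℕ}, L.BoundedFormula α k → Prop
  | e1 {n k : ℕ} {φ : L.BoundedFormula α k} : IsE1 φ → IsExistsNE1 n φ
  | ex {n k : ℕ} {φ : L.BoundedFormula α (k + 1)} : IsExistsNE1 n φ → IsExistsNE1 (n + 1) φ.ex

/-- The `∃^n`-fragments, defined inductively: `∃^0`-formulas are the quantifier-free ones,
and an `∃^{n+1}`-formula is of the form `ψ` or `∃ x ψ` with `ψ` a positive boolean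
combination of `∃^n`-formulas. -/
def IsExpN {L : Language} {α : Type*} : ℕ → ∀ {k : ℕ}, L.BoundedFormula α k → Prop
  | 0, _, φ => φ.IsQF
  | n + 1, k, φ => IsPosBC (IsExpN n) φ ∨
      ∃ ψ : L.BoundedFormula α (k + 1), IsPosBC (IsExpN n) ψ ∧ φ = ψ.ex



/-! ### The language of rings with constants, and realization -/

/-- The `Language.ring`-structure on a ring. -/
noncomputable def ringStructure (M : Type*) [CommRing M] : Language.ring.Structure M :=
  (FirstOrder.Ring.compatibleRingOfRing M).toStructure

/-- The `L_ring(α)`-structure on a ring `M` with constants interpreted via `f : α → M`. -/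
noncomputable def ringConStructure {α M : Type*} [CommRing M] (f : α → M) :
    (Language.ring[[α]]).Structure M :=
  letI := ringStructure M
  letI := constantsOn.structure f
  inferInstance

/-- `M ⊨ φ` for an `L_ring(α)`-sentence, with constants interpreted via `f`. -/
def RealizeRing (M : Type*) [CommRing M] {α : Type*} (f : α → M)
    (φ : (Language.ring[[α]]).Sentence) : Prop :=
  @Sentence.Realize _ M (ringConStructure f) φ

/-- The unary relation symbol `O` for the valuation ring. -/
inductive ValRel : ℕ → Type
  | isO : ValRel 1

/-- The language with a single unary predicate `O`. -/
def oLang : Language := ⟨fun _ => Empty, ValRel⟩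

/-- The language of valued fields `L_val = L_ring ∪ {O}`. -/
abbrev Lval : Language := Language.ring.sum oLang

/-- The `oLang`-structure on `M` in which `O` is interpreted as the set `O`. -/
def oStructure {M : Type*} (O : Set M) : oLang.Structure M where
  funMap := fun f _ => f.elim
  RelMap := fun {_} r => match r with
    | .isO => fun xs => xs 0 ∈ O

/-- The `L_val(α)`-structure on a ring `M`, with `O` interpreted as the set `O` and
constants interpreted via `f : α → M`. -/
noncomputable def valConStructure {α M : Type*} [CommRing M] (O : Set M) (f : α → M) :
    (Lval[[α]]).Structure M :=
  letI := ringStructure M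
  letI := oStructure O
  letI : Lval.Structure M := inferInstance
  letI := constantsOn.structure f
  inferInstance

/-- `M ⊨ φ` for an `L_val(α)`-sentence. -/
def RealizeVal (M : Type*) [CommRing M] (O : Set M) {α : Type*} (f : α → M)
    (φ : (Lval[[α]]).Sentence) : Prop :=
  @Sentence.Realize _ M (valConStructure O f) φ



abbrev Zm0 : Type := WithZero (Multiplicative ℤ)

variable {K : Type*} [Field K] {Γ : Type*} [LinearOrderedCommGroupWithZero Γ]

/-- `π` is a uniformizer of `(K, v)`: `v π` is minimal positive
(multiplicatively: `0 < v π < 1` and `v π` is the largest value `< 1`). -/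
def IsUniformizer (v : Valuation K Γ) (π : K) : Prop :=
  0 < v π ∧ v π < 1 ∧ ∀ x : K, v x < 1 → v x ≤ v π

/-- The valuation ring of `v`, as a set. -/
def Oset (v : Valuation K Γ) : Set K := {x | v x ≤ 1}

/-- The residue field `Kv` of the valued field `(K, v)`. -/
abbrev ResF (v : Valuation K Γ) : Type _ :=
  IsLocalRing.ResidueField v.valuationSubring

/-- The residue map `O_v → Kv`. -/
abbrev resMap (v : Valuation K Γ) : v.valuationSubring →+* ResF v :=
  IsLocalRing.residue _

/-- `(K, v)` is a henselian valued field. -/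
abbrev IsHenselian (v : Valuation K Γ) : Prop :=
  HenselianLocalRing v.valuationSubring

/-- compatibility of a ring homomorphism between residue fields with the residue maps,
for an extension `(K, v)` of `(C, u)`. -/
def ResCompat {C : Type*} [Field C] {Γ₀ : Type*} [LinearOrderedCommGroupWithZero Γ₀]
    (u : Valuation C Γ₀) [Algebra C K] (v : Valuation K Γ)
    (g : ResF u →+* ResF v) : Prop :=
  ∀ (x : u.valuationSubring) (hx : algebraMap C K ↑x ∈ v.valuationSubring),
    g (resMap u x) = resMap v ⟨algebraMap C K ↑x, hx⟩

/-- `(K, v)` is complete (with respect to the valuation uniformity). -/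
def IsCompleteValued (v : Valuation K Γ) : Prop :=
  letI : Valued K Γ := Valued.mk' v
  CompleteSpace K



/-- `E/F` admits a separating transcendence basis. -/
def HasSepTransBasis (F E : Type*) [Field F] [Field E] [Algebra F E] : Prop :=
  ∃ s : Set E, AlgebraicIndependent F ((↑) : s → E) ∧
    Algebra.IsSeparable (IntermediateField.adjoin F s) E

/-- The field extension `E/F` is separable: every finitely generated subextension
admits a separating transcendence basis. -/
def IsSepExt (F E : Type*) [Field F] [Field E] [Algebra F E] : Prop :=
  ∀ s : Finset E, HasSepTransBasis F (IntermediateField.adjoin F (s : Set E))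

/-- The extension given by a ring homomorphism `f : F →+* E` of fields is separable. -/
def IsSepExtHom {F E : Type*} [Field F] [Field E] (f : F →+* E) : Prop :=
  letI := f.toAlgebra
  IsSepExt F E

/-- `trdeg(E/F) ≤ d`: there is a finite transcendence basis with at most `d` elements. -/
def TrdegLE (F E : Type*) [CommRing F] [CommRing E] [Algebra F E] (d : ℕ) : Prop :=
  ∃ s : Finset E, s.card ≤ d ∧ IsTranscendenceBasis F (Subtype.val : ((s : Set E)) → E)

/-- `F` is a large field: `F` is existentially closed in `F((t))`. -/
def LargeField (F : Type u) [Field F] : Prop :=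
  ∀ φ : (Language.ring[[F]]).Sentence, IsExists φ →
    RealizeRing (LaurentSeries F) (algebraMap F (LaurentSeries F)) φ →
    RealizeRing F (id : F → F) φ

/-- `(R4_n)`: whenever a valuation `w` on a field `E` is trivial on a large subfield `F` of `E`
with residue field `Eu = F` (via the residue map), every `∃_n`-`L_ring(F)`-sentence true in `E`
is true in `F`. -/
def R4N (n : ℕ) : Prop :=
  ∀ (E : Type u) [Field E] (Γ : Type u) [LinearOrderedCommGroupWithZero Γ]
    (w : Valuation E Γ) (F : Subfield E),
    LargeField.{u} F →
    (∀ y : F, (y : E) ≠ 0 → w y = 1) →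
    (∀ y : E, w y ≤ 1 → ∃ x : F, w (y - x) < 1) →
    ∀ φ : (Language.ring[[F]]).Sentence, IsExistsN n φ →
      RealizeRing E ((↑) : F → E) φ → RealizeRing F (id : F → F) φ

/-- Excellence of the valuation ring of an (equicharacteristic, `ℤ`-valued) valued field
`(C, u)`, via the characterization: the fraction field of the completion (i.e. the completion
of `C`) is a separable extension of `C`. -/
def ExcellentCompletion (C : Type u) [Field C] (u : Valuation C Zm0) : Prop :=
  letI : Valued C Zm0 := Valued.mk' u
  letI : Field (UniformSpace.Completion C) := UniformSpace.Completion.instField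
  IsSepExtHom (UniformSpace.Completion.coeRingHom : C →+* UniformSpace.Completion C)


/-- `Th_P(K, fK) ⊆ Th_P(L, fL)`: every positive boolean combination of `L_ring(α)`-sentences
of the fragment `P` that is true in `K` is true in `L`. -/
def ThRingSub {α : Type*} (P : ∀ {k : ℕ}, (Language.ring[[α]]).BoundedFormula Empty k → Prop)
    (K : Type*) [CommRing K] (fK : α → K) (L : Type*) [CommRing L] (fL : α → L) : Prop :=
  ∀ φ : (Language.ring[[α]]).Sentence, IsPosBC P φ →
    RealizeRing K fK φ → RealizeRing L fL φ

/-- `Th_P(K, OK, fK) ⊆ Th_P(L, OL, fL)` for `L_val(α)`-sentences. -/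
def ThValSub {α : Type*} (P : ∀ {k : ℕ}, (Lval[[α]]).BoundedFormula Empty k → Prop)
    (K : Type*) [CommRing K] (OK : Set K) (fK : α → K)
    (L : Type*) [CommRing L] (OL : Set L) (fL : α → L) : Prop :=
  ∀ φ : (Lval[[α]]).Sentence, IsPosBC P φ →
    RealizeVal K OK fK φ → RealizeVal L OL fL φ

end Paper

namespace Paper

section ModelTheory

variable {α : Type u}

/-- The value in `M` of a term of `L_ring(α)`, constants being interpreted via `f`. -/
noncomputable def termVal {M : Type*} [CommRing M] (f : α → M) {β : Type*}
    (t : (Language.ring[[α]]).Term β) (v : β → M) : M :=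
  @Term.realize _ M (ringConStructure f) _ v t

/-- The truth value in `M` of an `L_ring(α)`-formula without free variables. -/
def FormVal {M : Type*} [CommRing M] (f : α → M) {k : ℕ}
    (φ : (Language.ring[[α]]).BoundedFormula Empty k) (xs : Fin k → M) : Prop :=
  @BoundedFormula.Realize _ M (ringConStructure f) _ _ φ Empty.elim xs

theorem realizeRing_iff_formVal {M : Type*} [CommRing M] (f : α → M)
    (φ : (Language.ring[[α]]).Sentence) : RealizeRing M f φ ↔ FormVal f φ default := by
  unfold RealizeRing FormVal Sentence.Realize Formula.Realize
  rw [Subsingleton.elim (default : Empty → M) Empty.elim]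

theorem map_funMap {M N : Type*} [CommRing M] [CommRing N] (h : M →+* N) (f : α → M) {l : ℕ}
    (F : (Language.ring[[α]]).Functions l) (xs : Fin l → M) :
    h (@Structure.funMap _ M (ringConStructure f) l F xs) =
      @Structure.funMap _ N (ringConStructure (h ∘ f)) l F (h ∘ xs) := by
  cases F with
  | inl F =>
    cases F with
    | add => exact map_add h _ _
    | mul => exact map_mul h _ _
    | neg => exact map_neg h _
    | zero => exact map_zero h
    | one => exact map_one h
  | inr F =>
    match l, F with
    | 0, c => rfl

theorem map_termVal {M N : Type*} [CommRing M] [CommRing N] (h : M →+* N) (f : α → M) {β : Type*}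
    (t : (Language.ring[[α]]).Term β) (v : β → M) :
    h (termVal f t v) = termVal (h ∘ f) t (h ∘ v) := by
  induction t with
  | var => rfl
  | func F ts ih =>
    refine (map_funMap h f F _).trans ?_
    exact congrArg _ (funext ih)

theorem formVal_eq {M : Type*} [CommRing M] (f : α → M) {k : ℕ}
    (t₁ t₂ : (Language.ring[[α]]).Term (Empty ⊕ Fin k)) (xs : Fin k → M) :
    FormVal f (t₁.bdEqual t₂) xs ↔
      termVal f t₁ (Sum.elim Empty.elim xs) = termVal f t₂ (Sum.elim Empty.elim xs) :=
  Iff.rfl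

theorem formVal_imp {M : Type*} [CommRing M] (f : α → M) {k : ℕ}
    (φ ψ : (Language.ring[[α]]).BoundedFormula Empty k) (xs : Fin k → M) :
    FormVal f (φ.imp ψ) xs ↔ (FormVal f φ xs → FormVal f ψ xs) :=
  Iff.rfl

theorem formVal_ex {M : Type*} [CommRing M] (f : α → M) {k : ℕ}
    (φ : (Language.ring[[α]]).BoundedFormula Empty (k + 1)) (xs : Fin k → M) :
    FormVal f φ.ex xs ↔ ∃ a, FormVal f φ (Fin.snoc xs a) :=
  @BoundedFormula.realize_ex _ M (ringConStructure f) _ _ _ _ _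

theorem comp_sumElim_empty {M N : Type*} {k : ℕ} (h : M → N) (xs : Fin k → M) :
    h ∘ (Sum.elim Empty.elim xs : Empty ⊕ Fin k → M) = Sum.elim Empty.elim (h ∘ xs) := by
  rw [Sum.comp_elim]
  congr
  exact Subsingleton.elim _ _

/-- The truth value of a quantifier-free formula in a domain `A` is preserved by every ring
homomorphism which does not kill a certain nonzero element. -/
theorem exists_ne_zero_formVal_iff {A : Type*} [CommRing A] [IsDomain A] (c : α → A) {k : ℕ}
    {φ : (Language.ring[[α]]).BoundedFormula Empty k} (hφ : φ.IsQF) (xs : Fin k → A) :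
    ∃ a : A, a ≠ 0 ∧ ∀ (N : Type v) [CommRing N] (θ : A →+* N), θ a ≠ 0 →
      (FormVal c φ xs ↔ FormVal (θ ∘ c) φ (θ ∘ xs)) := by
  induction hφ with
  | falsum => exact ⟨1, one_ne_zero, fun N _ θ _ => Iff.rfl⟩
  | of_isAtomic h =>
    cases h with
    | equal t₁ t₂ =>
      by_cases h : termVal c t₁ (Sum.elim Empty.elim xs) = termVal c t₂ (Sum.elim Empty.elim xs)
      · refine ⟨1, one_ne_zero, fun N _ θ _ => ?_⟩
        rw [formVal_eq, formVal_eq, ← comp_sumElim_empty, ← map_termVal, ← map_termVal, h]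
        simp
      · refine ⟨_, sub_ne_zero.mpr h, fun N _ θ hθ => ?_⟩
        rw [formVal_eq, formVal_eq, ← comp_sumElim_empty, ← map_termVal, ← map_termVal]
        rw [map_sub, sub_ne_zero] at hθ
        exact ⟨fun e => absurd e h, fun e => absurd e hθ⟩
    | rel R ts =>
      rcases R with R | R <;> exact R.elim
  | imp _ _ ih₁ ih₂ =>
    obtain ⟨a, ha, h₁⟩ := ih₁
    obtain ⟨b, hb, h₂⟩ := ih₂
    refine ⟨a * b, mul_ne_zero ha hb, fun N _ θ hθ => ?_⟩
    rw [map_mul] at hθ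
    rw [formVal_imp, formVal_imp, h₁ N θ (left_ne_zero_of_mul hθ), h₂ N θ (right_ne_zero_of_mul hθ)]

theorem formVal_iff_of_injective {A : Type*} {N : Type v} [CommRing A] [IsDomain A] [CommRing N]
    {θ : A →+* N} (hθ : Function.Injective θ) (c : α → A) {k : ℕ}
    {φ : (Language.ring[[α]]).BoundedFormula Empty k} (hφ : φ.IsQF) (xs : Fin k → A) :
    FormVal c φ xs ↔ FormVal (θ ∘ c) φ (θ ∘ xs) := by
  obtain ⟨a, ha, h⟩ := exists_ne_zero_formVal_iff.{u, v} c hφ xs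
  exact h N θ ((map_ne_zero_iff θ hθ).mpr ha)

theorem FormVal.map_of_injective {A : Type*} {N : Type v} [CommRing A] [IsDomain A] [CommRing N]
    {θ : A →+* N} (hθ : Function.Injective θ) (c : α → A) {n k : ℕ}
    {φ : (Language.ring[[α]]).BoundedFormula Empty k} (hφ : IsExistsN n φ) (xs : Fin k → A)
    (h : FormVal c φ xs) : FormVal (θ ∘ c) φ (θ ∘ xs) := by
  induction hφ with
  | qf hφ => exact (formVal_iff_of_injective hθ c hφ xs).mp h
  | ex _ ih =>
    rw [formVal_ex] at h ⊢
    obtain ⟨a, ha⟩ := h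
    refine ⟨θ a, ?_⟩
    rw [← Fin.comp_snoc]
    exact ih _ ha

theorem RealizeRing.map_of_injective {A : Type*} {N : Type v} [CommRing A] [IsDomain A]
    [CommRing N] {θ : A →+* N} (hθ : Function.Injective θ) (c : α → A) {n : ℕ}
    {φ : (Language.ring[[α]]).Sentence} (hφ : IsExistsN n φ) (h : RealizeRing A c φ) :
    RealizeRing N (θ ∘ c) φ := by
  rw [realizeRing_iff_formVal] at h ⊢
  rw [Subsingleton.elim (default : Fin 0 → N) (θ ∘ default)]
  exact h.map_of_injective hθ c hφ _

theorem thRingSub_of_forall {P : ∀ {k : ℕ}, (Language.ring[[α]]).BoundedFormula Empty k → Prop}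
    {M N : Type*} [CommRing M] [CommRing N] {f : α → M} {f' : α → N}
    (H : ∀ φ : (Language.ring[[α]]).Sentence, P φ → RealizeRing M f φ → RealizeRing N f' φ) :
    ThRingSub P M f N f' := by
  have key : ∀ {k : ℕ} (φ : (Language.ring[[α]]).BoundedFormula Empty k), IsPosBC P φ → k = 0 →
      ∀ xs ys, FormVal f φ xs → FormVal f' φ ys := by
    intro k φ hφ
    induction hφ with
    | @base φ h =>
      rintro rfl xs ys hx
      have := H φ h
      rw [realizeRing_iff_formVal, realizeRing_iff_formVal] at this
      rw [Subsingleton.elim ys default]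
      rw [Subsingleton.elim xs default] at hx
      exact this hx
    | inf _ _ ih₁ ih₂ =>
      rintro rfl xs ys h
      have h' := (@BoundedFormula.realize_inf _ M (ringConStructure f) _ _ _ _ _ _).mp h
      exact (@BoundedFormula.realize_inf _ N (ringConStructure f') _ _ _ _ _ _).mpr
        ⟨ih₁ rfl xs ys h'.1, ih₂ rfl xs ys h'.2⟩
    | sup _ _ ih₁ ih₂ =>
      rintro rfl xs ys h
      have h' := (@BoundedFormula.realize_sup _ M (ringConStructure f) _ _ _ _ _ _).mp h
      exact (@BoundedFormula.realize_sup _ N (ringConStructure f') _ _ _ _ _ _).mpr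
        (h'.imp (ih₁ rfl xs ys) (ih₂ rfl xs ys))
  intro φ hφ
  rw [realizeRing_iff_formVal, realizeRing_iff_formVal]
  exact key φ hφ rfl _ _

/-- Constants may be renamed along an arbitrary map. -/
theorem exists_isExistsN_realizeRing_iff {β : Type u} (e : α → β) {n : ℕ}
    {φ : (Language.ring[[α]]).Sentence} (hφ : IsExistsN n φ) :
    ∃ ψ : (Language.ring[[β]]).Sentence, IsExistsN n ψ ∧
      ∀ (M : Type v) [CommRing M] (f : β → M), RealizeRing M f ψ ↔ RealizeRing M (f ∘ e) φ := by
  let g : Language.ring[[α]] →ᴸ Language.ring[[β]] :=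
    Language.ring.lhomWithConstantsMap e
  have hex : ∀ {n k : ℕ} {φ : (Language.ring[[α]]).BoundedFormula Empty k}, IsExistsN n φ →
      IsExistsN n (g.onBoundedFormula φ) := by
    intro n k φ h
    induction h with
    | qf h =>
      refine .qf ?_
      induction h with
      | falsum => exact .falsum
      | of_isAtomic h =>
        cases h with
        | equal t₁ t₂ => exact .of_isAtomic (.equal _ _)
        | rel R ts => exact .of_isAtomic (.rel _ _)
      | imp _ _ ih₁ ih₂ => exact ih₁.imp ih₂
    | ex _ ih => exact .ex ih
  refine ⟨g.onSentence φ, hex hφ, fun M _ f => ?_⟩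
  let _ := ringConStructure f
  let _ := ringConStructure (f ∘ e)
  have : g.IsExpansionOn M :=
    { map_onFunction := fun {l} F xs => by
        rcases F with F | F
        · rfl
        · match l, F with
          | 0, c => rfl
      map_onRelation := fun {l} R xs => by rcases R with R | R <;> exact R.elim }
  exact LHom.realize_onSentence M g φ

end ModelTheory

section Ultrapower

variable {ι : Type*} (U : Ultrafilter ι)

/-- The diagonal embedding of a ring into its ultrapower. -/
noncomputable def germDiag (M : Type*) [CommRing M] : M →+* Filter.Germ (U : Filter ι) M :=
  (Filter.Germ.coeRingHom (U : Filter ι)).comp (Pi.constRingHom ι M)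

theorem germDiag_injective (M : Type*) [CommRing M] : Function.Injective (germDiag U M) :=
  fun _ _ h => Filter.Germ.const_inj.mp h

/-- The ultrapower of a ring homomorphism. -/
noncomputable def germMap {M N : Type*} [CommRing M] [CommRing N] (f : M →+* N) :
    Filter.Germ (U : Filter ι) M →+* Filter.Germ (U : Filter ι) N where
  toFun := Filter.Germ.map f
  map_one' := congrArg (Filter.Germ.ofFun (l := (U : Filter ι))) (funext fun _ => map_one f)
  map_zero' := congrArg (Filter.Germ.ofFun (l := (U : Filter ι))) (funext fun _ => map_zero f)
  map_mul' a b := Filter.Germ.inductionOn₂ a b fun _ _ =>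
    congrArg (Filter.Germ.ofFun (l := (U : Filter ι))) (funext fun _ => map_mul f _ _)
  map_add' a b := Filter.Germ.inductionOn₂ a b fun _ _ =>
    congrArg (Filter.Germ.ofFun (l := (U : Filter ι))) (funext fun _ => map_add f _ _)

theorem germMap_coe {M N : Type*} [CommRing M] [CommRing N] (f : M →+* N) (a : ι → M) :
    germMap U f (a : Filter.Germ (U : Filter ι) M) = ((f ∘ a : ι → N) : Filter.Germ _ N) := rfl

theorem formVal_germ_iff {α : Type u} {M : Type*} [CommRing M] (c : α → ι → M) {k : ℕ}
    {φ : (Language.ring[[α]]).BoundedFormula Empty k} (hφ : φ.IsQF) (xs : Fin k → ι → M) :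
    FormVal (Filter.Germ.coeRingHom (U : Filter ι) ∘ c) φ
        (Filter.Germ.coeRingHom (U : Filter ι) ∘ xs) ↔
      ∀ᶠ i in (U : Filter ι), FormVal (fun a => c a i) φ (fun j => xs j i) := by
  induction hφ with
  | falsum => exact (Filter.eventually_const (p := False)).symm
  | of_isAtomic h =>
    cases h with
    | equal t₁ t₂ =>
      rw [formVal_eq, ← comp_sumElim_empty, ← map_termVal, ← map_termVal]
      refine Filter.Germ.coe_eq.trans (Filter.eventually_congr (.of_forall fun i => ?_))
      have h₁ := map_termVal (Pi.evalRingHom (fun _ => M) i) c t₁ (Sum.elim Empty.elim xs)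
      have h₂ := map_termVal (Pi.evalRingHom (fun _ => M) i) c t₂ (Sum.elim Empty.elim xs)
      rw [comp_sumElim_empty] at h₁ h₂
      rw [formVal_eq]
      exact iff_of_eq (congrArg₂ (· = ·) h₁ h₂)
    | rel R ts => rcases R with R | R <;> exact R.elim
  | imp _ _ ih₁ ih₂ =>
    rw [formVal_imp, ih₁, ih₂, ← Ultrafilter.eventually_imp]
    rfl

theorem FormVal.eventually_of_germ {α : Type u} {M : Type*} [CommRing M] (c : α → ι → M) {n k : ℕ}
    {φ : (Language.ring[[α]]).BoundedFormula Empty k} (hφ : IsExistsN n φ) (xs : Fin k → ι → M)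
    (h : FormVal (Filter.Germ.coeRingHom (U : Filter ι) ∘ c) φ
        (Filter.Germ.coeRingHom (U : Filter ι) ∘ xs)) :
    ∀ᶠ i in (U : Filter ι), FormVal (fun a => c a i) φ (fun j => xs j i) := by
  induction hφ with
  | qf hφ => exact (formVal_germ_iff U c hφ xs).mp h
  | ex _ ih =>
    rw [formVal_ex] at h
    obtain ⟨a, ha⟩ := h
    induction a using Filter.Germ.inductionOn with | _ a =>
    refine (ih (Fin.snoc xs a) ?_).mono fun i hi => ?_
    · rw [Fin.comp_snoc]
      exact ha
    · rw [formVal_ex]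
      refine ⟨a i, ?_⟩
      have := Fin.comp_snoc (fun b : ι → M => b i) xs a
      rw [Function.comp_def] at this
      rw [this] at hi
      exact hi

/-- Existential sentences true in an ultrapower are true in the base structure. -/
theorem RealizeRing.of_germ {α : Type u} {M : Type*} [CommRing M] (c : α → M) {n : ℕ}
    {φ : (Language.ring[[α]]).Sentence} (hφ : IsExistsN n φ)
    (h : RealizeRing (Filter.Germ (U : Filter ι) M) (germDiag U M ∘ c) φ) :
    RealizeRing M c φ := by
  rw [realizeRing_iff_formVal] at h ⊢
  rw [Subsingleton.elim (default : Fin 0 → Filter.Germ (U : Filter ι) M)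
    (Filter.Germ.coeRingHom (U : Filter ι) ∘ default)] at h
  have := FormVal.eventually_of_germ U (fun a _ => c a) hφ default h
  obtain ⟨i, hi⟩ := this.exists
  rwa [Subsingleton.elim (default : Fin 0 → M)]

theorem isDomain_germ (M : Type*) [CommRing M] [IsDomain M] :
    IsDomain (Filter.Germ (U : Filter ι) M) := by
  have : NoZeroDivisors (Filter.Germ (U : Filter ι) M) := by
    refine ⟨fun {a b} => ?_⟩
    induction a using Filter.Germ.inductionOn with | _ a =>
    induction b using Filter.Germ.inductionOn with | _ b =>
    intro h
    have h' : ∀ᶠ i in (U : Filter ι), a i * b i = 0 := Filter.Germ.coe_eq.mp h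
    simp_rw [mul_eq_zero, Ultrafilter.eventually_or] at h'
    exact h'.imp (fun h => Filter.Germ.coe_eq.mpr h) (fun h => Filter.Germ.coe_eq.mpr h)
  exact NoZeroDivisors.to_isDomain _

theorem germ_dvd_total {M : Type*} [CommRing M] (h : ∀ a b : M, a ∣ b ∨ b ∣ a)
    (a b : Filter.Germ (U : Filter ι) M) : a ∣ b ∨ b ∣ a := by
  induction a using Filter.Germ.inductionOn with | _ a =>
  induction b using Filter.Germ.inductionOn with | _ b =>
  have key : ∀ a b : ι → M, (∀ᶠ i in (U : Filter ι), a i ∣ b i) →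
      (a : Filter.Germ (U : Filter ι) M) ∣ b := by
    intro a b hab
    choose! c hc using fun i (h : a i ∣ b i) => h
    exact ⟨(c : ι → M), Filter.Germ.coe_eq.mpr (hab.mono hc)⟩
  have : ∀ᶠ i in (U : Filter ι), a i ∣ b i ∨ b i ∣ a i := .of_forall fun i => h _ _
  rw [Ultrafilter.eventually_or] at this
  exact this.imp (key a b) (key b a)

theorem germMap_surjective {M N : Type*} [CommRing M] [CommRing N] {f : M →+* N}
    (hf : Function.Surjective f) : Function.Surjective (germMap U f) := by
  intro b
  induction b using Filter.Germ.inductionOn with | _ b =>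
  choose a ha using fun i => hf (b i)
  exact ⟨(a : ι → M), congrArg _ (funext ha)⟩

theorem isUnit_of_germMap_ne_zero {M N : Type*} [CommRing M] [CommRing N] {f : M →+* N}
    (hf : ∀ a, f a ≠ 0 → IsUnit a) (a : Filter.Germ (U : Filter ι) M)
    (h : germMap U f a ≠ 0) : IsUnit a := by
  induction a using Filter.Germ.inductionOn with | _ a =>
  have h' : ∀ᶠ i in (U : Filter ι), ∃ b, a i * b = 1 := by
    have : ∀ᶠ i in (U : Filter ι), ¬ f (a i) = 0 := by
      rw [Ultrafilter.eventually_not]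
      exact fun h' => h (Filter.Germ.coe_eq.mpr h')
    exact this.mono fun i hi => (hf _ hi).exists_right_inv
  choose! b hb using fun i (h : ∃ b, a i * b = 1) => h
  exact IsUnit.of_mul_eq_one (b : Filter.Germ (U : Filter ι) M)
    (Filter.Germ.coe_eq.mpr (h'.mono hb))

/-- A version of Hensel's lemma for a ring homomorphism `π : O → F`. -/
def HenselLift {O F : Type*} [CommRing O] [CommRing F] (π : O →+* F) : Prop :=
  ∀ f : Polynomial O, f.Monic → ∀ a : O, π (f.eval a) = 0 → π (f.derivative.eval a) ≠ 0 →
    ∃ b : O, f.eval b = 0 ∧ π b = π a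

theorem HenselLift.germMap {O F : Type*} [CommRing O] [CommRing F] {π : O →+* F}
    (h : HenselLift π) : HenselLift (germMap U π) := by
  intro f hf a
  have hs : Function.Surjective (Filter.Germ.coeRingHom (R := O) (U : Filter ι)) :=
    fun b => Filter.Germ.inductionOn b fun b => ⟨b, rfl⟩
  obtain ⟨q, rfl, -, hq⟩ := Polynomial.lifts_and_natDegree_eq_and_monic
    (Polynomial.mem_lifts_of_surjective hs f) hf
  induction a using Filter.Germ.inductionOn with | _ a =>
  intro h₁ h₂
  have e : ∀ (r : Polynomial (ι → O)) (b : ι → O),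
      (r.map (Filter.Germ.coeRingHom (U : Filter ι))).eval (b : Filter.Germ (U : Filter ι) O) =
        ((fun i => (r.map (Pi.evalRingHom _ i)).eval (b i) : ι → O) : Filter.Germ _ O) := by
    intro r b
    refine (Polynomial.eval_map_apply (Filter.Germ.coeRingHom (U : Filter ι)) b).trans ?_
    refine congrArg (Filter.Germ.ofFun (l := (U : Filter ι))) (funext fun i => ?_)
    exact (Polynomial.eval_map_apply (Pi.evalRingHom (fun _ => O) i) b).symm
  rw [e, germMap_coe] at h₁
  rw [Polynomial.derivative_map, e, germMap_coe] at h₂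
  have h₁' := Filter.Germ.coe_eq.mp h₁
  have h₂' : ∀ᶠ i in (U : Filter ι),
      ¬ π (((Polynomial.derivative q).map (Pi.evalRingHom _ i)).eval (a i)) = 0 := by
    rw [Ultrafilter.eventually_not]
    exact fun h' => h₂ (Filter.Germ.coe_eq.mpr h')
  have key : ∀ᶠ i in (U : Filter ι), ∃ b, (q.map (Pi.evalRingHom _ i)).eval b = 0 ∧
      π b = π (a i) := by
    filter_upwards [h₁', h₂'] with i hi₁ hi₂
    rw [← Polynomial.derivative_map] at hi₂
    exact h _ (hq.map _) _ hi₁ hi₂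
  choose! b hb using fun i (h : ∃ b, (q.map (Pi.evalRingHom _ i)).eval b = 0 ∧
      π b = π (a i)) => h
  refine ⟨(b : ι → O), ?_, ?_⟩
  · rw [e]
    exact Filter.Germ.coe_eq.mpr (key.mono fun i hi => (hb i hi).1)
  · exact Filter.Germ.coe_eq.mpr (key.mono fun i hi => (hb i hi).2)

end Ultrapower

section Separability

/-- Over a field of characteristic `p`, a `p`-polynomial relation forces a linear one. -/
theorem exists_linear_of_sum_mul_pow_eq_zero {F : Type*} [Field F] {p : ℕ} [ExpChar F p]
    {ι : Type*} [Fintype ι] {c : ι → F} (hc : c ≠ 0) :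
    ∃ l : ι → F, l ≠ 0 ∧ ∀ y : ι → F, ∑ i, c i * y i ^ p = 0 → ∑ i, y i * l i = 0 := by
  classical
  let V : Submodule F (ι → F) :=
    { carrier := {y | ∑ i, c i * y i ^ p = 0}
      zero_mem' := by simp [(expChar_pos F p).ne']
      add_mem' := fun {a b} ha hb => by
        simp only [Set.mem_ofPred_eq, Pi.add_apply, add_pow_expChar, mul_add,
          Finset.sum_add_distrib] at *
        rw [ha, hb, add_zero]
      smul_mem' := fun r a ha => by
        simp only [Set.mem_ofPred_eq, Pi.smul_apply, smul_eq_mul, mul_pow, mul_left_comm (c _),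
          ← Finset.mul_sum] at *
        rw [ha, mul_zero] }
  have hV : V < ⊤ := by
    refine lt_top_iff_ne_top.mpr fun h => hc (funext fun i => ?_)
    have : Pi.single i 1 ∈ V := h ▸ Submodule.mem_top
    have : ∑ j, c j * (Pi.single i 1 : ι → F) j ^ p = 0 := this
    rw [Finset.sum_eq_single i] at this
    · simpa using this
    · intro j _ hj
      simp [hj, (expChar_pos F p).ne']
    · simp
  obtain ⟨f, hf, hVf⟩ := V.exists_le_ker_of_lt_top hV
  refine ⟨fun i => f fun j => if i = j then 1 else 0, fun h => hf ?_, fun y hy => ?_⟩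
  · refine LinearMap.ext fun y => ?_
    rw [LinearMap.pi_apply_eq_sum_univ]
    exact Finset.sum_eq_zero fun i _ => by rw [congrFun h i]; simp
  · have : f y = 0 := hVf hy
    rwa [LinearMap.pi_apply_eq_sum_univ] at this

/-- A criterion for separability of a field extension: linear independence is preserved by
raising to the `p`-th power. -/
theorem isSepExtHom_of_pow {F : Type*} {E : Type v} [Field F] [Field E] (f : F →+* E)
    (p : ℕ) [ExpChar F p]
    (H : ∀ {ι : Type v} [Fintype ι] (x : ι → E) (c : ι → F), c ≠ 0 →
      ∑ i, f (c i) * x i ^ p = 0 → ∃ l : ι → F, l ≠ 0 ∧ ∑ i, x i * f (l i) = 0) :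
    IsSepExtHom f := by
  let _ := f.toAlgebra
  intro T
  let E' := IntermediateField.adjoin F (T : Set E)
  have : Algebra.EssFiniteType F E' :=
    IntermediateField.essFiniteType_iff.mpr (IntermediateField.fg_adjoin_finset T)
  have main : ∃ s : Finset E', IsTranscendenceBasis F ((↑) : s → E') ∧
      Algebra.IsSeparable (IntermediateField.adjoin F (s : Set E')) E' := by
    rcases ‹ExpChar F p› with _ | hp
    · exact exists_isTranscendenceBasis_and_isSeparable_of_perfectField F E'
    · have : ExpChar F p := .prime hp
      refine exists_isTranscendenceBasis_and_isSeparable_of_linearIndepOn_pow_of_essFiniteType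
        p hp fun s hs => ?_
      have hs' : LinearIndependent F ((↑) : s → E') := hs
      change LinearIndependent F fun i : s => (i : E') ^ p
      rw [Fintype.linearIndependent_iff] at hs' ⊢
      intro c hc
      by_contra! hne
      obtain ⟨j, hj⟩ := hne
      obtain ⟨l, hl, hl'⟩ := H (fun i : s => ((i : E') : E)) c
        (fun h => hj (congrFun h j)) (by
          have := congrArg (algebraMap E' E) hc
          simpa [Algebra.smul_def, f.algebraMap_toAlgebra] using this)
      refine hl (funext fun i => hs' l (Subtype.ext ?_) i)
      have : ∑ i, l i • ((i : E') : E) = 0 := by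
        rw [← hl']
        exact Finset.sum_congr rfl fun i _ => by rw [Algebra.smul_def, mul_comm]; rfl
      simpa using this
  obtain ⟨s, hs, hs'⟩ := main
  exact ⟨s, hs.1, hs'⟩

theorem isSepExtHom_germDiag {ι : Type*} (U : Ultrafilter ι) (F : Type*) [Field F] :
    IsSepExtHom (germDiag U F) := by
  obtain ⟨p, _⟩ := ExpChar.exists F
  refine isSepExtHom_of_pow _ p fun {κ} _ x c hc h => ?_
  obtain ⟨l, hl, H⟩ := exists_linear_of_sum_mul_pow_eq_zero (p := p) hc
  refine ⟨l, hl, ?_⟩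
  have hs : Function.Surjective (Filter.Germ.coeRingHom (R := F) (U : Filter ι)) :=
    fun b => Filter.Germ.inductionOn b fun b => ⟨b, rfl⟩
  choose y hy using fun i => hs (x i)
  simp only [← hy, germDiag, RingHom.comp_apply, ← map_pow, ← map_mul, ← map_sum] at h ⊢
  refine Filter.Germ.coe_eq.mpr ((Filter.Germ.coe_eq.mp h).mono fun j hj => ?_)
  have := H (fun i => y i j) (by simpa using hj)
  simpa using this

theorem isSepExtHom_laurentSeries (F : Type*) [Field F] :
    IsSepExtHom (algebraMap F (LaurentSeries F)) := by
  obtain ⟨p, _⟩ := ExpChar.exists F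
  refine isSepExtHom_of_pow _ p fun {κ} _ x c hc h => ?_
  obtain ⟨l, hl, H⟩ := exists_linear_of_sum_mul_pow_eq_zero (p := p) hc
  refine ⟨l, hl, ?_⟩
  obtain ⟨b, hb⟩ := IsLocalization.exist_integer_multiples_of_finite
    (Submonoid.powers (PowerSeries.X : PowerSeries F)) x
  choose y hy using hb
  have hb0 : algebraMap (PowerSeries F) (LaurentSeries F) b ≠ 0 :=
    (IsLocalization.map_units (LaurentSeries F) b).ne_zero
  simp only [Algebra.smul_def] at hy
  have ha : ∀ r : F, algebraMap F (LaurentSeries F) r =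
      algebraMap (PowerSeries F) (LaurentSeries F) (PowerSeries.C r) := fun r => by
    rw [HahnSeries.algebraMap_apply', HahnSeries.algebraMap_apply']
    rfl
  have h1 : ∑ i, PowerSeries.C (c i) * y i ^ p = 0 := by
    apply IsFractionRing.injective (PowerSeries F) (LaurentSeries F)
    simp only [map_sum, map_mul, map_pow, hy, map_zero, mul_pow, ← ha]
    simp only [mul_left_comm (algebraMap F _ _), ← Finset.mul_sum, h, mul_zero]
  have h2 : ∑ i, y i * PowerSeries.C (l i) = 0 := by
    ext k
    have := congrArg (PowerSeries.coeff (p * k)) h1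
    simp only [map_sum, PowerSeries.coeff_C_mul, map_zero] at this
    have hk : ∀ i, PowerSeries.coeff (p * k) (y i ^ p) = PowerSeries.coeff k (y i) ^ p := by
      intro i
      have hp := (expChar_pos F p).ne'
      have e := MvPowerSeries.map_frobenius_expand (σ := Unit) (f := y i) p hp
      refine (congrArg (PowerSeries.coeff (p * k)) e.symm).trans ?_
      refine (PowerSeries.coeff_map _ _ _).trans ?_
      exact congrArg _ (PowerSeries.coeff_expand_mul p hp (y i) k)
    simp only [hk] at this
    have := H _ this
    simpa using this
  have h3 := congrArg (algebraMap (PowerSeries F) (LaurentSeries F)) h2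
  simp only [map_sum, map_mul, hy, map_zero, ← ha, mul_assoc, ← Finset.mul_sum] at h3
  exact (mul_eq_zero.mp h3).resolve_left hb0

end Separability

section Sections

theorem finiteDimensional_of_isSeparable_of_essFiniteType (M E : Type*) [Field M] [Field E]
    [Algebra M E] [Algebra.EssFiniteType M E] [Algebra.IsSeparable M E] :
    FiniteDimensional M E := by
  obtain ⟨s, hs⟩ := IntermediateField.fg_top M E
  have := IntermediateField.finiteDimensional_adjoin (K := M) (S := (s : Set E))
    fun x _ => Algebra.IsSeparable.isIntegral M x
  rw [hs] at this
  exact Module.Finite.equiv IntermediateField.topEquiv.toLinearEquiv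

theorem exists_lift_of_isSeparable {M E : Type*} [Field M] [Field E] [Algebra M E]
    [FiniteDimensional M E] [Algebra.IsSeparable M E] {O F : Type*} [CommRing O] [Field F]
    {π : O →+* F} (hπ : Function.Surjective π) (hens : HenselLift π)
    (σ : M →+* O) (j : E →+* F) (h : π.comp σ = j.comp (algebraMap M E)) :
    ∃ ζ : E →+* O, π.comp ζ = j ∧ ζ.comp (algebraMap M E) = σ := by
  let pb := Field.powerBasisOfFiniteOfSeparable M E
  have hg : IsIntegral M pb.gen := Algebra.IsSeparable.isIntegral M _
  obtain ⟨a, ha⟩ := hπ (j pb.gen)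
  have e : ∀ q : Polynomial M, π ((q.map σ).eval a) = j (Polynomial.aeval pb.gen q) := by
    intro q
    rw [← Polynomial.eval_map_apply, Polynomial.map_map, h, ← Polynomial.map_map, ha,
      Polynomial.eval_map_apply, Polynomial.eval_map_algebraMap]
  obtain ⟨b, hb, hb'⟩ := hens ((minpoly M pb.gen).map σ) ((minpoly.monic hg).map σ) a
    (by rw [e, minpoly.aeval, map_zero])
    (by
      rw [Polynomial.derivative_map, e, Ne, map_eq_zero]
      exact (Algebra.IsSeparable.isSeparable M pb.gen).aeval_derivative_ne_zero
        (minpoly.aeval M _))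
  let _ : Algebra M O := σ.toAlgebra
  let _ : Algebra M F := (π.comp σ).toAlgebra
  have hb0 : Polynomial.aeval b (minpoly M pb.gen) = 0 := by
    rwa [← Polynomial.eval_map_algebraMap]
  let ζ := pb.lift b hb0
  refine ⟨ζ, ?_, ζ.comp_algebraMap⟩
  let π' : O →ₐ[M] F := { π with commutes' := fun _ => rfl }
  let j' : E →ₐ[M] F := { j with commutes' := fun r => (RingHom.congr_fun h r).symm }
  have : π'.comp ζ = j' := pb.algHom_ext (by
    change π (ζ pb.gen) = j pb.gen
    rw [pb.lift_gen, hb', ha])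
  exact congrArg AlgHom.toRingHom this

theorem exists_lift_of_algebraicIndependent {L E ι : Type*} [Field L] [Field E] [Algebra L E]
    {x : ι → E} (hx : AlgebraicIndependent L x) {O F : Type*} [CommRing O] [Field F]
    {π : O →+* F} (hπ : Function.Surjective π) (loc : ∀ y, π y ≠ 0 → IsUnit y)
    (a : L →+* O) (j : E →+* F) (h : π.comp a = j.comp (algebraMap L E)) :
    ∃ σ : IntermediateField.adjoin L (Set.range x) →+* O,
      π.comp σ = j.comp (algebraMap _ E) ∧ σ.comp (algebraMap L _) = a := by
  choose y hy using fun i => hπ (j (x i))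
  let σ₀ : MvPolynomial ι L →+* O := MvPolynomial.eval₂Hom a y
  have h₀ : ∀ q, π (σ₀ q) = j (MvPolynomial.aeval x q) := by
    intro q
    have : π.comp σ₀ = j.comp (MvPolynomial.aeval x : _ →ₐ[L] E).toRingHom := by
      refine MvPolynomial.ringHom_ext (fun r => ?_) (fun i => ?_)
      · simpa [σ₀] using RingHom.congr_fun h r
      · simpa [σ₀] using hy i
    exact RingHom.congr_fun this q
  have hu : ∀ q : nonZeroDivisors (MvPolynomial ι L), IsUnit (σ₀ q) := by
    intro q
    apply loc
    rw [h₀, map_ne_zero]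
    exact fun h => nonZeroDivisors.ne_zero q.2
      ((map_eq_zero_iff _ (algebraicIndependent_iff_injective_aeval.mp hx)).mp h)
  let σ₁ : FractionRing (MvPolynomial ι L) →+* O := IsLocalization.lift hu
  have h₁ : π.comp σ₁ =
      (j.comp (algebraMap _ E)).comp hx.aevalEquivField.toRingEquiv.toRingHom := by
    refine IsLocalization.ringHom_ext (nonZeroDivisors (MvPolynomial ι L)) (RingHom.ext fun q => ?_)
    have := hx.aevalEquivField_algebraMap_apply_coe q
    simp only [RingHom.comp_apply, σ₁, IsLocalization.lift_eq, h₀]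
    exact congrArg j this.symm
  refine ⟨σ₁.comp hx.aevalEquivField.symm.toRingEquiv.toRingHom, ?_, ?_⟩
  · rw [← RingHom.comp_assoc, h₁]
    ext z
    simp
  · ext r
    have : algebraMap L (FractionRing (MvPolynomial ι L)) r =
      algebraMap (MvPolynomial ι L) _ (MvPolynomial.C r) := rfl
    simp [σ₁, σ₀, this]

/-- Sections of the residue map exist on finitely generated subfields. -/
theorem exists_section_adjoin {O F L : Type*} [CommRing O] [Field F] [Field L]
    {π : O →+* F} (hπ : Function.Surjective π) (loc : ∀ y, π y ≠ 0 → IsUnit y)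
    (hens : HenselLift π) (a : L →+* O) (sep : IsSepExtHom (π.comp a)) (T : Finset F) :
    ∃ (E : Subfield F) (ζ : E →+* O), (T : Set F) ⊆ E ∧ (∀ x, π (ζ x) = x) ∧
      ∀ l, ∃ h : π (a l) ∈ E, ζ ⟨π (a l), h⟩ = a l := by
  let _ : Algebra L F := (π.comp a).toAlgebra
  let E := IntermediateField.adjoin L (T : Set F)
  obtain ⟨s, hs, _⟩ := sep T
  obtain ⟨σ, hσ, hσa⟩ := exists_lift_of_algebraicIndependent hs hπ loc a
    (algebraMap E F) rfl
  let M := IntermediateField.adjoin L (Set.range ((↑) : s → E))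
  have : Algebra.IsSeparable M E := by
    unfold M
    rwa [Subtype.range_coe]
  have : Algebra.EssFiniteType L E :=
    IntermediateField.essFiniteType_iff.mpr (IntermediateField.fg_adjoin_finset T)
  have : Algebra.EssFiniteType M E := .of_comp L M E
  have := finiteDimensional_of_isSeparable_of_essFiniteType M E
  obtain ⟨ζ, hζ, hζσ⟩ := exists_lift_of_isSeparable hπ hens σ (algebraMap E F) hσ
  refine ⟨E.toSubfield, ζ, IntermediateField.subset_adjoin L _, RingHom.congr_fun hζ,
    fun l => ⟨E.algebraMap_mem l, ?_⟩⟩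
  exact (RingHom.congr_fun hζσ (algebraMap L M l)).trans (RingHom.congr_fun hσa l)

end Sections

section GermSection

theorem exists_germ_section {O F L : Type*} [CommRing O] [Field F] [Field L]
    {π : O →+* F} (hπ : Function.Surjective π) (loc : ∀ y, π y ≠ 0 → IsUnit y)
    (hens : HenselLift π) (a : L →+* O) (sep : IsSepExtHom (π.comp a))
    (U : Ultrafilter (Finset F)) (hU : (U : Filter (Finset F)) ≤ Filter.atTop) :
    ∃ ζ : F →+* Filter.Germ (U : Filter (Finset F)) O,
      (germMap U π).comp ζ = germDiag U F ∧
      ζ.comp (π.comp a) = (germDiag U O).comp a := by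
  classical
  choose E ζ hT hζ ha using exists_section_adjoin hπ loc hens a sep
  let z : F → Finset F → O := fun y T => if h : y ∈ E T then ζ T ⟨y, h⟩ else 0
  have hz : ∀ y T (h : y ∈ E T), z y T = ζ T ⟨y, h⟩ := fun y T h => dif_pos h
  have hE : ∀ y, ∀ᶠ T in (U : Filter (Finset F)), y ∈ E T := fun y =>
    hU ((Filter.eventually_ge_atTop {y}).mono fun T h => hT T (h (Finset.mem_singleton_self y)))
  let Z : F →+* Filter.Germ (U : Filter (Finset F)) O :=
    { toFun := fun y => (z y : Filter.Germ (U : Filter (Finset F)) O)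
      map_one' := Filter.Germ.coe_eq.mpr (.of_forall fun T => by
        rw [hz 1 T (one_mem _)]
        exact map_one (ζ T))
      map_zero' := Filter.Germ.coe_eq.mpr (.of_forall fun T => by
        rw [hz 0 T (zero_mem _)]
        exact map_zero (ζ T))
      map_mul' := fun x y => Filter.Germ.coe_eq.mpr (by
        filter_upwards [hE x, hE y] with T hx hy
        rw [hz _ T (mul_mem hx hy), hz _ T hx, hz _ T hy, ← map_mul]
        rfl)
      map_add' := fun x y => Filter.Germ.coe_eq.mpr (by
        filter_upwards [hE x, hE y] with T hx hy
        rw [hz _ T (add_mem hx hy), hz _ T hx, hz _ T hy, ← map_add]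
        rfl) }
  refine ⟨Z, RingHom.ext fun y => ?_, RingHom.ext fun l => ?_⟩
  · refine Filter.Germ.coe_eq.mpr ((hE y).mono fun T h => ?_)
    change π (z y T) = y
    rw [hz y T h, hζ]
  · refine Filter.Germ.coe_eq.mpr (.of_forall fun T => ?_)
    obtain ⟨h, h'⟩ := ha T l
    exact (hz _ T h).trans h'

end GermSection

section Hensel

open Polynomial in
/-- Hensel's lemma at `0` for polynomials which are not necessarily monic. -/
theorem HenselLift.exists_root {O F : Type*} [CommRing O] [Field F] {π : O →+* F}
    (loc : ∀ y, π y ≠ 0 → IsUnit y) (hens : HenselLift π) (f : Polynomial O)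
    (h₀ : π (f.eval 0) = 0) (h₁ : π (f.derivative.eval 0) ≠ 0) :
    ∃ b, f.eval b = 0 ∧ π b = 0 := by
  obtain ⟨a, c, r, rfl⟩ : ∃ (a c : O) (r : Polynomial O), f = C a + X * (C c + X * r) := by
    refine ⟨f.coeff 0, f.divX.coeff 0, f.divX.divX, ?_⟩
    linear_combination -f.divX_mul_X_add - X * f.divX.divX_mul_X_add
  replace h₀ : π a = 0 := by simpa using h₀
  replace h₁ : π c ≠ 0 := by simpa using h₁
  let N := r.natDegree
  let s : Polynomial O := ∑ i ∈ Finset.range (N + 1), C (r.coeff i * a ^ i) * X ^ (N - i)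
  have hs : s.degree ≤ N := by
    refine (degree_sum_le _ _).trans (Finset.sup_le fun i _ => ?_)
    refine (degree_C_mul_X_pow_le _ _).trans ?_
    exact_mod_cast Nat.sub_le _ _
  let g : Polynomial O := X ^ (N + 2) + (C c * X ^ (N + 1) + C a * s)
  have hg : g.Monic := by
    refine monic_X_pow_add ((degree_add_le _ _).trans_lt (max_lt ?_ ?_))
    · refine (degree_C_mul_X_pow_le _ _).trans_lt ?_
      exact_mod_cast Nat.lt_succ_self _
    · rw [← smul_eq_C_mul]
      refine (degree_smul_le _ _).trans_lt (hs.trans_lt ?_)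
      exact_mod_cast (Nat.lt_add_of_pos_right two_pos)
  obtain ⟨V, hV, hV'⟩ := hens g hg (-c)
    (by
      simp only [g, eval_add, eval_mul, eval_C, eval_pow, eval_X, map_add, map_mul, map_pow,
        map_neg, h₀]
      ring)
    (by
      have : π (g.derivative.eval (-c)) = (-π c) ^ (N + 1) := by
        simp [g, h₀]
        ring
      rw [this]
      exact pow_ne_zero _ (neg_ne_zero.mpr h₁))
  obtain ⟨W, hW⟩ := (loc V (by rwa [hV', map_neg, neg_ne_zero])).exists_right_inv
  have hsV : s.eval V = V ^ N * r.eval (a * W) := by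
    simp only [s, eval_finsetSum, r.eval_eq_sum_range, Finset.mul_sum]
    refine Finset.sum_congr rfl fun i hi => ?_
    have : V ^ N = V ^ (N - i) * V ^ i := by
      rw [← pow_add, Nat.sub_add_cancel (Finset.mem_range_succ_iff.mp hi)]
    have h2 : V ^ i * W ^ i = 1 := by rw [← mul_pow, hW, one_pow]
    simp only [eval_mul, eval_C, eval_pow, eval_X]
    rw [this]
    linear_combination (-(r.coeff i) * a ^ i * V ^ (N - i)) * h2
  refine ⟨a * W, ?_, by rw [map_mul, h₀, zero_mul]⟩
  have hVu : IsUnit (V ^ (N + 2)) := (IsUnit.of_mul_eq_one W hW).pow _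
  refine (hVu.mul_right_eq_zero).mp ?_
  simp only [g, eval_add, eval_mul, eval_C, eval_pow, eval_X, hsV] at hV ⊢
  have e1 : V ^ (N + 2) * W = V ^ (N + 1) := by rw [pow_succ, mul_assoc, hW, mul_one]
  have e2 : V ^ (N + 1) * W = V ^ N := by rw [pow_succ, mul_assoc, hW, mul_one]
  linear_combination a * hV + (a * c + a ^ 2 * W * r.eval (a * W)) * e1 +
    a ^ 2 * r.eval (a * W) * e2

theorem isAdicComplete_powerSeries (F : Type*) [Field F] :
    IsAdicComplete (Ideal.span {(PowerSeries.X : PowerSeries F)}) (PowerSeries F) := by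
  have key : ∀ (n : ℕ) (x y : PowerSeries F),
      x ≡ y [SMOD (Ideal.span {(PowerSeries.X : PowerSeries F)} ^ n •
        (⊤ : Submodule (PowerSeries F) (PowerSeries F)))] ↔
      ∀ m < n, PowerSeries.coeff m x = PowerSeries.coeff m y := by
    intro n x y
    rw [SModEq.sub_mem, Ideal.span_singleton_pow, smul_eq_mul, Ideal.mul_top,
      Ideal.mem_span_singleton, PowerSeries.X_pow_dvd_iff]
    simp only [map_sub, sub_eq_zero]
  refine { haus' := fun x hx => ?_, prec' := fun f hf => ?_ }
  · ext n
    exact (key (n + 1) x 0).mp (hx _) n n.lt_succ_self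
  · refine ⟨PowerSeries.mk fun n => PowerSeries.coeff n (f (n + 1)), fun n => ?_⟩
    rw [key]
    intro m hm
    rw [PowerSeries.coeff_mk]
    exact ((key _ _ _).mp (hf (Nat.succ_le_of_lt hm)) m m.lt_succ_self).symm

theorem henselLift_constantCoeff (F : Type*) [Field F] :
    HenselLift (PowerSeries.constantCoeff (R := F)) := by
  intro f hf a h₀ h₁
  have := isAdicComplete_powerSeries F
  obtain ⟨b, hb, hb'⟩ := HenselianRing.is_henselian
    (I := Ideal.span {(PowerSeries.X : PowerSeries F)}) f hf a
    (by rwa [Ideal.mem_span_singleton, PowerSeries.X_dvd_iff])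
    (IsUnit.map _ (PowerSeries.isUnit_iff_constantCoeff.mpr h₁.isUnit))
  refine ⟨b, hb, ?_⟩
  rwa [Ideal.mem_span_singleton, PowerSeries.X_dvd_iff, map_sub, sub_eq_zero] at hb'

end Hensel

section Large

open Polynomial

/-- A first-order form of largeness, for plane curves which are smooth over the parameter `t` at
the origin: they have points in each nonempty open subset. -/
def PlaneLarge (F : Type*) [CommRing F] : Prop :=
  ∀ Q H : F[X][X], Q.evalEval 0 0 = 0 → (derivative Q).evalEval 0 0 ≠ 0 →
    H.evalEval 0 0 ≠ 0 → ∃ t y : F, t ≠ 0 ∧ Q.evalEval t y = 0 ∧ H.evalEval t y ≠ 0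

/-- `Q` is represented by an `L_ring(F)`-term in two variables. -/
def IsTermPoly {F : Type u} [CommRing F] (Q : F[X][X]) : Prop :=
  ∃ τ : (Language.ring[[F]]).Term (Empty ⊕ Fin 2),
    ∀ (N : Type u) [CommRing N] (h : F →+* N) (v : Fin 2 → N),
      termVal h τ (Sum.elim Empty.elim v) = (Q.map (mapRingHom h)).evalEval (v 0) (v 1)

theorem isTermPoly {F : Type u} [CommRing F] (Q : F[X][X]) : IsTermPoly Q := by
  have add : ∀ {P Q : F[X][X]}, IsTermPoly P → IsTermPoly Q → IsTermPoly (P + Q) := by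
    rintro P Q ⟨τ₁, h₁⟩ ⟨τ₂, h₂⟩
    refine ⟨Term.func (Sum.inl ringFunc.add) ![τ₁, τ₂], fun N _ h v => ?_⟩
    rw [Polynomial.map_add, evalEval_add, ← h₁, ← h₂]
    rfl
  have mul : ∀ {P Q : F[X][X]}, IsTermPoly P → IsTermPoly Q → IsTermPoly (P * Q) := by
    rintro P Q ⟨τ₁, h₁⟩ ⟨τ₂, h₂⟩
    refine ⟨Term.func (Sum.inl ringFunc.mul) ![τ₁, τ₂], fun N _ h v => ?_⟩
    rw [Polynomial.map_mul, evalEval_mul, ← h₁, ← h₂]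
    rfl
  have mul_pow : ∀ {P R : F[X][X]}, IsTermPoly P → IsTermPoly R → ∀ n : ℕ,
      IsTermPoly (P * R ^ n) := by
    intro P R hP hR n
    induction n with
    | zero => simpa using hP
    | succ n ih => rw [pow_succ, ← mul_assoc]; exact mul ih hR
  have hY : IsTermPoly (X : F[X][X]) :=
    ⟨Term.var (Sum.inr 1), fun N _ h v => by simp [termVal]⟩
  have hX : IsTermPoly (C X : F[X][X]) :=
    ⟨Term.var (Sum.inr 0), fun N _ h v => by simp [termVal, evalEval_C]⟩
  induction Q using Polynomial.induction_on' with
  | add P Q hP hQ => exact add hP hQ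
  | monomial n p =>
    rw [← C_mul_X_pow_eq_monomial]
    refine mul_pow ?_ hY n
    induction p using Polynomial.induction_on' with
    | add P Q hP hQ => rw [C_add]; exact add hP hQ
    | monomial m a =>
      rw [← C_mul_X_pow_eq_monomial, C_mul, C_pow]
      refine mul_pow ⟨Term.func (Sum.inr a : (Language.ring[[F]]).Functions 0) ![],
        fun N _ h v => ?_⟩ hX m
      rw [map_C, coe_mapRingHom, map_C, evalEval_CC]
      rfl

theorem exists_sentence_iff_evalEval {F : Type u} [CommRing F] (Q H : F[X][X]) :
    ∃ φ : (Language.ring[[F]]).Sentence, IsExists φ ∧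
      ∀ (N : Type u) [CommRing N] (h : F →+* N), RealizeRing N h φ ↔
        ∃ t y : N, (Q.map (mapRingHom h)).evalEval t y = 0 ∧
          (H.map (mapRingHom h)).evalEval t y ≠ 0 := by
  obtain ⟨τ, hτ⟩ := isTermPoly Q
  obtain ⟨ρ, hρ⟩ := isTermPoly H
  obtain ⟨ζ, hζ⟩ := isTermPoly (0 : F[X][X])
  refine ⟨((τ.bdEqual ζ) ⊓ ∼ (ρ.bdEqual ζ)).ex.ex, ⟨2, .ex (.ex (.qf ?_))⟩, fun N _ h => ?_⟩
  · exact (BoundedFormula.IsAtomic.equal _ _).isQF.inf (BoundedFormula.IsAtomic.equal _ _).isQF.not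
  · rw [realizeRing_iff_formVal, formVal_ex]
    refine exists_congr fun t => ?_
    rw [formVal_ex]
    refine exists_congr fun y => ?_
    have e : FormVal h ((τ.bdEqual ζ) ⊓ ∼ (ρ.bdEqual ζ))
        (Fin.snoc (Fin.snoc default t) y : Fin 2 → N) ↔
        FormVal h (τ.bdEqual ζ) (Fin.snoc (Fin.snoc default t) y : Fin 2 → N) ∧
        ¬ FormVal h (ρ.bdEqual ζ) (Fin.snoc (Fin.snoc default t) y : Fin 2 → N) :=
      @BoundedFormula.realize_inf _ N (ringConStructure h) _ _ _ _ _ _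
    rw [e, formVal_eq, formVal_eq, hτ, hρ, hζ, Polynomial.map_zero, evalEval_zero]
    rfl

theorem LargeField.planeLarge {F : Type u} [Field F] (hF : LargeField.{u} F) : PlaneLarge F := by
  intro Q H h₀ h₁ h₂
  obtain ⟨φ, hφ, hiff⟩ := exists_sentence_iff_evalEval Q (C X * H)
  have hC : (PowerSeries.constantCoeff (R := F)).comp PowerSeries.C = RingHom.id F := by
    ext; simp
  have hcc : ∀ (P : F[X][X]) (x y : PowerSeries F), PowerSeries.constantCoeff
      ((P.map (mapRingHom PowerSeries.C)).evalEval x y) =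
      P.evalEval (PowerSeries.constantCoeff x) (PowerSeries.constantCoeff y) := by
    intro P x y
    rw [← map_mapRingHom_evalEval, Polynomial.map_map, mapRingHom_comp, hC]
    simp
  have hev : ∀ (P : (PowerSeries F)[X][X]) (x y : PowerSeries F),
      P.evalEval x y = (P.map (evalRingHom x)).eval y := by
    intro P x y
    rw [← eval₂_evalRingHom, eval_map]
  have := hF φ hφ ((hiff _ (algebraMap F (LaurentSeries F))).mpr ?_)
  · obtain ⟨t, y, hQ, hH⟩ := (hiff F (RingHom.id F)).mp this
    refine ⟨t, y, ?_, ?_, ?_⟩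
    · rintro rfl
      simp [evalEval_C] at hH
    · simpa using hQ
    · intro h
      simp [h] at hH
  · obtain ⟨y, hy, hy'⟩ := HenselLift.exists_root
      (fun y hy => PowerSeries.isUnit_iff_constantCoeff.mpr (IsUnit.mk0 _ hy))
      (henselLift_constantCoeff F)
      ((Q.map (mapRingHom PowerSeries.C)).map (evalRingHom (PowerSeries.X : PowerSeries F)))
      (by rw [← hev, hcc]; simpa using h₀)
      (by rw [derivative_map, derivative_map, ← hev, hcc]; simpa using h₁)
    have key : ∀ P : F[X][X], (P.map (mapRingHom (algebraMap F (LaurentSeries F)))).evalEval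
        (algebraMap (PowerSeries F) (LaurentSeries F) PowerSeries.X)
        (algebraMap (PowerSeries F) (LaurentSeries F) y) =
        algebraMap (PowerSeries F) (LaurentSeries F)
          ((P.map (mapRingHom PowerSeries.C)).evalEval PowerSeries.X y) := by
      intro P
      rw [← map_mapRingHom_evalEval, Polynomial.map_map, mapRingHom_comp]
      rfl
    refine ⟨algebraMap (PowerSeries F) (LaurentSeries F) PowerSeries.X,
      algebraMap (PowerSeries F) (LaurentSeries F) y, ?_, ?_⟩
    · rw [key, hev, hy, map_zero]
    · rw [key, map_ne_zero_iff _ (IsFractionRing.injective (PowerSeries F) (LaurentSeries F)),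
        Polynomial.map_mul, evalEval_mul]
      refine mul_ne_zero ?_ fun h => h₂ ?_
      · simp [evalEval_C]
      · have := hcc H PowerSeries.X y
        rw [h, hy'] at this
        simpa using this.symm

theorem PlaneLarge.germ {F : Type*} [CommRing F] (hF : PlaneLarge F) {ι : Type*}
    (U : Ultrafilter ι) : PlaneLarge (Filter.Germ (U : Filter ι) F) := by
  intro Q H h₀ h₁ h₂
  have hs : Function.Surjective (Filter.Germ.coeRingHom (R := F) (U : Filter ι)) :=
    fun b => Filter.Germ.inductionOn b fun b => ⟨b, rfl⟩
  obtain ⟨Q, rfl⟩ := Polynomial.map_surjective (mapRingHom _) (Polynomial.map_surjective _ hs) Q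
  obtain ⟨H, rfl⟩ := Polynomial.map_surjective (mapRingHom _) (Polynomial.map_surjective _ hs) H
  have key : ∀ (P : (ι → F)[X][X]) (x y : ι → F),
      (P.map (mapRingHom (Filter.Germ.coeRingHom (R := F) (U : Filter ι)))).evalEval
        (x : Filter.Germ (U : Filter ι) F) y = 0 ↔
      ∀ᶠ i in (U : Filter ι),
        (P.map (mapRingHom (Pi.evalRingHom _ i))).evalEval (x i) (y i) = 0 := by
    intro P x y
    have e1 := map_mapRingHom_evalEval (Filter.Germ.coeRingHom (R := F) (U : Filter ι)) P x y
    have e2 := fun i => map_mapRingHom_evalEval (Pi.evalRingHom (fun _ : ι => F) i) P x y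
    simp only [Pi.evalRingHom_apply] at e2
    simp_rw [e2]
    exact (iff_of_eq (congrArg (· = 0) e1)).trans Filter.Germ.coe_eq
  have h₀' := (key Q 0 0).mp h₀
  have h₁' : ∀ᶠ i in (U : Filter ι), ¬ _ := Ultrafilter.eventually_not.mpr
    fun h => h₁ (by rw [derivative_map]; exact (key (derivative Q) 0 0).mpr h)
  have h₂' : ∀ᶠ i in (U : Filter ι), ¬ _ := Ultrafilter.eventually_not.mpr
    fun h => h₂ ((key H 0 0).mpr h)
  have : ∀ᶠ i in (U : Filter ι), ∃ t y : F, t ≠ 0 ∧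
      (Q.map (mapRingHom (Pi.evalRingHom _ i))).evalEval t y = 0 ∧
      (H.map (mapRingHom (Pi.evalRingHom _ i))).evalEval t y ≠ 0 := by
    filter_upwards [h₀', h₁', h₂'] with i h₀ h₁ h₂
    exact hF _ _ h₀ (by rw [derivative_map]; exact h₁) h₂
  have : ∃ t y : ι → F, ∀ᶠ i in (U : Filter ι), t i ≠ 0 ∧
      (Q.map (mapRingHom (Pi.evalRingHom _ i))).evalEval (t i) (y i) = 0 ∧
      (H.map (mapRingHom (Pi.evalRingHom _ i))).evalEval (t i) (y i) ≠ 0 := by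
    obtain ⟨t, ht⟩ := this.choice
    obtain ⟨y, hy⟩ := ht.choice
    exact ⟨t, y, hy⟩
  obtain ⟨t, y, h⟩ := this
  refine ⟨(t : Filter.Germ (U : Filter ι) F), (y : Filter.Germ (U : Filter ι) F),
    fun ht => ?_, (key Q t y).mpr (h.mono fun i hi => hi.2.1), fun ht => ?_⟩
  · obtain ⟨i, hi, hi'⟩ := (h.and (Filter.Germ.coe_eq.mp ht)).exists
    exact hi.1 hi'
  · obtain ⟨i, hi, hi'⟩ := (h.and ((key H t y).mp ht)).exists
    exact hi.2.2 hi'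

/-- `PlaneLarge` passes to rings which are exhausted by images of rings satisfying it. -/
theorem PlaneLarge.of_exhaust {R : Type*} [CommRing R]
    (h : ∀ s : Finset R, ∃ (F : Type u) (_ : CommRing F) (θ : F →+* R),
      PlaneLarge F ∧ Function.Injective θ ∧ ∀ x ∈ s, x ∈ θ.range) : PlaneLarge R := by
  intro Q H h₀ h₁ h₂
  classical
  have lift : ∀ P : R[X][X], ∃ s : Finset R, ∀ (F : Type u) [CommRing F] (θ : F →+* R),
      (∀ x ∈ s, x ∈ θ.range) → ∃ P' : F[X][X], P'.map (mapRingHom θ) = P := by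
    intro P
    induction P using Polynomial.induction_on' with
    | add P Q hP hQ =>
      obtain ⟨s, hs⟩ := hP
      obtain ⟨t, ht⟩ := hQ
      refine ⟨s ∪ t, fun F _ θ h => ?_⟩
      obtain ⟨P', rfl⟩ := hs F θ fun x hx => h x (Finset.mem_union_left _ hx)
      obtain ⟨Q', rfl⟩ := ht F θ fun x hx => h x (Finset.mem_union_right _ hx)
      exact ⟨P' + Q', Polynomial.map_add _⟩
    | monomial n p =>
      induction p using Polynomial.induction_on' with
      | add P Q hP hQ =>
        obtain ⟨s, hs⟩ := hP
        obtain ⟨t, ht⟩ := hQ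
        refine ⟨s ∪ t, fun F _ θ h => ?_⟩
        obtain ⟨P', hP'⟩ := hs F θ fun x hx => h x (Finset.mem_union_left _ hx)
        obtain ⟨Q', hQ'⟩ := ht F θ fun x hx => h x (Finset.mem_union_right _ hx)
        exact ⟨P' + Q', by rw [Polynomial.map_add, hP', hQ', ← map_add]⟩
      | monomial m a =>
        refine ⟨{a}, fun F _ θ h => ?_⟩
        obtain ⟨b, rfl⟩ := h a (Finset.mem_singleton_self a)
        exact ⟨monomial n (monomial m b), by simp⟩
  obtain ⟨s, hs⟩ := lift Q
  obtain ⟨t, ht⟩ := lift H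
  obtain ⟨F, _, θ, hF, hθ, hst⟩ := h (s ∪ t)
  obtain ⟨Q, rfl⟩ := hs F θ fun x hx => hst x (Finset.mem_union_left _ hx)
  obtain ⟨H, rfl⟩ := ht F θ fun x hx => hst x (Finset.mem_union_right _ hx)
  have key : ∀ (P : F[X][X]) (x y : F),
      (P.map (mapRingHom θ)).evalEval (θ x) (θ y) = θ (P.evalEval x y) :=
    map_mapRingHom_evalEval θ
  rw [← map_zero θ, key] at h₀ h₂
  rw [derivative_map, ← map_zero θ, key] at h₁
  obtain ⟨t, y, h1, h2, h3⟩ := hF Q H (hθ h₀) (fun h => h₁ (by rw [h])) (fun h => h₂ (by rw [h]))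
  refine ⟨θ t, θ y, (map_ne_zero_iff θ hθ).mpr h1, by rw [key, h2, map_zero], ?_⟩
  rw [key]
  exact (map_ne_zero_iff θ hθ).mpr h3

end Large

section Approximation

open Polynomial

/-- Evaluation of a polynomial in `Y` over `F[x]` at a point. -/
noncomputable abbrev pointEval {F ι S : Type*} [CommRing F] [CommRing S] [Algebra F S]
    (x : ι → S) (y : S) : (MvPolynomial ι F)[X] →+* S :=
  eval₂RingHom (MvPolynomial.aeval x : MvPolynomial ι F →ₐ[F] S).toRingHom y

theorem map_pointEval {F ι S S' : Type*} [CommRing F] [CommRing S] [Algebra F S] [CommRing S']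
    [Algebra F S'] (f : S →ₐ[F] S') (x : ι → S) (y : S) (P : (MvPolynomial ι F)[X]) :
    f (pointEval x y P) = pointEval (f ∘ x) (f y) P := by
  suffices f.toRingHom.comp (pointEval (F := F) x y) = pointEval (f ∘ x) (f y) from
    RingHom.congr_fun this P
  ext <;> simp

theorem X_pow_dvd_pointEval_sub {F ι : Type*} [Field F] (x : ι → PowerSeries F)
    (α : PowerSeries F) (N : ℕ) (P : (MvPolynomial ι F)[X]) :
    (PowerSeries.X : PowerSeries F) ^ N ∣ pointEval x α P -
      ((pointEval (fun i => (x i).trunc N) (α.trunc N) P : F[X]) : PowerSeries F) := by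
  have key (a : PowerSeries F) : (PowerSeries.X : PowerSeries F) ^ N ∣ a - (a.trunc N : F[X]) := by
    rw [PowerSeries.X_pow_dvd_iff]
    intro m hm
    simp [PowerSeries.coeff_trunc, hm]
  have h2 := map_pointEval (Polynomial.coeToPowerSeries.algHom (R := F) F)
    (fun i => (x i).trunc N) (α.trunc N) P
  simp only [Polynomial.coeToPowerSeries.algHom_apply, Algebra.algebraMap_self,
    PowerSeries.map_id, id_eq] at h2
  rw [h2]
  let I := Ideal.span {(PowerSeries.X : PowerSeries F) ^ N}
  rw [← Ideal.mem_span_singleton, ← Ideal.Quotient.mk_eq_mk_iff_sub_mem]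
  rw [← Ideal.Quotient.mkₐ_eq_mk F, map_pointEval, map_pointEval]
  congr 1
  congr 1
  · funext i
    simp [Ideal.Quotient.mk_eq_mk_iff_sub_mem, Ideal.mem_span_singleton, key]
  · simp [Ideal.Quotient.mk_eq_mk_iff_sub_mem, Ideal.mem_span_singleton, key]

theorem exists_eq_X_pow_mul_of_trunc {F : Type*} [Field F] {a : PowerSeries F} (ha : a ≠ 0) :
    ∃ e : ℕ, ∀ N > e, ∀ p : F[X],
      (PowerSeries.X : PowerSeries F) ^ N ∣ a - (p : PowerSeries F) →
        ∃ u : F[X], p = X ^ e * u ∧ u.eval 0 ≠ 0 := by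
  refine ⟨a.order.toNat, fun N hN p hp => ?_⟩
  rw [PowerSeries.X_pow_dvd_iff] at hp
  have hc : ∀ m < N, p.coeff m = PowerSeries.coeff m a := fun m hm => by
    have := hp m hm
    simp only [map_sub, Polynomial.coeff_coe] at this
    exact (sub_eq_zero.mp this).symm
  obtain ⟨u, hu⟩ : (X : F[X]) ^ a.order.toNat ∣ p := by
    rw [Polynomial.X_pow_dvd_iff]
    intro d hd
    rw [hc d (hd.trans hN), PowerSeries.coeff_of_lt_order_toNat d hd]
  refine ⟨u, hu, ?_⟩
  have h1 : p.coeff (a.order.toNat) = u.coeff 0 := by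
    rw [hu, Polynomial.coeff_X_pow_mul', if_pos le_rfl, Nat.sub_self]
  rw [← Polynomial.coeff_zero_eq_eval_zero, ← h1, hc _ hN]
  exact PowerSeries.coeff_order ha

theorem PlaneLarge.exists_point {F ι : Type*} [Field F] (hF : PlaneLarge F)
    (x : ι → PowerSeries F) (α : PowerSeries F) (P H : (MvPolynomial ι F)[X])
    (hP : pointEval x α P = 0) (hP' : pointEval x α (derivative P) ≠ 0)
    (hH : pointEval x α H ≠ 0) :
    ∃ (σ : ι → F) (η : F), pointEval σ η P = 0 ∧ pointEval σ η H ≠ 0 := by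
  obtain ⟨e, he⟩ := exists_eq_X_pow_mul_of_trunc hP'
  obtain ⟨k, hk⟩ := exists_eq_X_pow_mul_of_trunc hH
  let M := e + k + 1
  let N := e + M + 1
  let p : ι → F[X] := fun i => (x i).trunc N
  let q : F[X] := α.trunc N
  obtain ⟨s, hs⟩ : (X : F[X]) ^ N ∣ pointEval p q P := by
    have := X_pow_dvd_pointEval_sub x α N P
    rw [hP, zero_sub, dvd_neg, PowerSeries.X_pow_dvd_iff] at this
    rw [Polynomial.X_pow_dvd_iff]
    intro d hd
    rw [← Polynomial.coeff_coe]
    exact this d hd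
  obtain ⟨a, ha, ha0⟩ := he N (by omega) _ (X_pow_dvd_pointEval_sub x α N _)
  obtain ⟨b, hb, hb0⟩ := hk N (by omega) _ (X_pow_dvd_pointEval_sub x α N _)
  let g : MvPolynomial ι F →+* F[X] := (MvPolynomial.aeval p : _ →ₐ[F] F[X]).toRingHom
  -- substitution `Y = q + X ^ M * Z`
  have ev (G : (MvPolynomial ι F)[X]) :
      eval (C q) ((G.map g).map C) = C (pointEval p q G) := by
    rw [eval_map, eval₂_at_apply, eval_map]
    rfl
  obtain ⟨R, hR⟩ := ((P.map g).map C).binomExpansion (C q) (C (X ^ M) * X)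
  obtain ⟨R', hR'⟩ := ((H.map g).map C).evalSubFactor (C q + C (X ^ M) * X) (C q)
  rw [derivative_map, derivative_map, ev, ev, hs, ha] at hR
  rw [ev, hb] at hR'
  have sp (G : (MvPolynomial ι F)[X]) (t y : F) :
      (eval (C q + C (X ^ M) * X) ((G.map g).map C)).evalEval t y =
        pointEval (fun i => (p i).eval t) (q.eval t + t ^ M * y) G := by
    suffices (evalEvalRingHom t y).comp ((evalRingHom (C q + C (X ^ M) * X)).comp
        ((mapRingHom C).comp (mapRingHom g))) =
        pointEval (fun i => (p i).eval t) (q.eval t + t ^ M * y) from RingHom.congr_fun this G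
    ext <;> simp [g]
    exact mul_comm _ _
  let Q : F[X][X] := C (X * s) + C a * X + R * C (X ^ (k + 1)) * X ^ 2
  let H' : F[X][X] := C b + R' * C (X ^ (e + 1)) * X
  have hQ : eval (C q + C (X ^ M) * X) ((P.map g).map C) = C (X ^ (e + M)) * Q := by
    rw [hR]
    simp only [Q, N, M, map_mul, map_pow]
    ring
  have hQH : eval (C q + C (X ^ M) * X) ((H.map g).map C) = C (X ^ k) * H' := by
    rw [sub_eq_iff_eq_add.mp hR']
    simp only [H', M, map_mul, map_pow]
    ring
  obtain ⟨t, y, ht, hy, hy'⟩ := hF Q H' (by simp [Q, evalEval_C]) (by simp [Q, evalEval_C, ha0])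
    (by simp [H', evalEval_C, hb0])
  refine ⟨_, _, (sp P t y).symm.trans ?_, fun h => ?_⟩
  · rw [hQ, evalEval_mul, hy, mul_zero]
  · have := (sp H t y).trans h
    rw [hQH, evalEval_mul] at this
    exact (mul_ne_zero (by simp [evalEval_C, ht]) hy') this

end Approximation

section GermHom

open Polynomial

theorem PlaneLarge.exists_germ_hom {F ι : Type u} [Field F] {M E : Type*} [Field M] [Field E]
    [Algebra (MvPolynomial ι F) M] [IsFractionRing (MvPolynomial ι F) M] [Algebra M E]
    (hF : PlaneLarge F) (pb : PowerBasis M E) (hsep : IsSeparable M pb.gen)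
    (x : ι → PowerSeries F) (α : PowerSeries F) (j : E →+* LaurentSeries F)
    (hj : ∀ q : MvPolynomial ι F, j (algebraMap M E (algebraMap _ M q)) =
      algebraMap (PowerSeries F) (LaurentSeries F) (MvPolynomial.aeval x q))
    (hα : j pb.gen = algebraMap (PowerSeries F) (LaurentSeries F) α) :
    ∃ (κ : Type u) (U : Ultrafilter κ) (θ : E →+* Filter.Germ (U : Filter κ) F), ∀ r : F,
      θ (algebraMap M E (algebraMap (MvPolynomial ι F) M (MvPolynomial.C r))) =
        germDiag U F r := by
  have hinj : Function.Injective (algebraMap (PowerSeries F) (LaurentSeries F)) :=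
    IsFractionRing.injective _ _
  have ev (G : (MvPolynomial ι F)[X]) :
      algebraMap (PowerSeries F) (LaurentSeries F) (pointEval x α G) =
        j (aeval pb.gen (G.map (algebraMap _ M))) := by
    suffices (algebraMap (PowerSeries F) (LaurentSeries F)).comp (pointEval x α) =
        (j.comp (aeval (R := M) pb.gen).toRingHom).comp (mapRingHom (algebraMap _ M)) from
      RingHom.congr_fun this G
    refine Polynomial.ringHom_ext (fun q => ?_) ?_
    · rw [RingHom.comp_apply, RingHom.comp_apply, RingHom.comp_apply, coe_mapRingHom, map_C]
      simp only [coe_eval₂RingHom, eval₂_C]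
      exact (hj q).symm.trans (congrArg j (aeval_C (A := E) pb.gen _).symm)
    · simpa using hα.symm
  let m := minpoly M pb.gen
  let P := IsLocalization.integerNormalization (nonZeroDivisors (MvPolynomial ι F)) m
  obtain ⟨b, hbm, hb⟩ : ∃ b ∈ nonZeroDivisors (MvPolynomial ι F),
      P.map (algebraMap _ M) = C (algebraMap _ M b) * m := by
    obtain ⟨b, hbm, hb⟩ := IsLocalization.integerNormalization_spec
      (nonZeroDivisors (MvPolynomial ι F)) m
    refine ⟨b, hbm, hb.trans ?_⟩
    ext i
    simp [Algebra.smul_def]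
  have hb0 : algebraMap _ M b ≠ 0 :=
    IsLocalization.to_map_ne_zero_of_mem_nonZeroDivisors M le_rfl hbm
  have hP : pointEval x α P = 0 := by
    apply hinj
    rw [ev, hb]
    simp [m]
  have hP' : pointEval x α (derivative P) ≠ 0 := by
    rw [← map_ne_zero_iff _ hinj, ev, ← derivative_map, hb, derivative_C_mul, map_mul, map_mul,
      aeval_C]
    exact mul_ne_zero (by simp [hb0])
      ((map_ne_zero j).mpr (hsep.aeval_derivative_ne_zero (minpoly.aeval M _)))
  have pt (T : Finset (MvPolynomial ι F)[X]) : ∃ (σ : ι → F) (η : F), pointEval σ η P = 0 ∧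
      ∀ G ∈ T, pointEval x α G ≠ 0 → pointEval σ η G ≠ 0 := by
    classical
    obtain ⟨σ, η, h, h'⟩ := hF.exists_point x α P (∏ G ∈ T with pointEval x α G ≠ 0, G) hP hP'
      (by
        rw [map_prod, Finset.prod_ne_zero_iff]
        exact fun G hG => (Finset.mem_filter.mp hG).2)
    rw [map_prod, Finset.prod_ne_zero_iff] at h'
    exact ⟨σ, η, h, fun G hG hG' => h' G (Finset.mem_filter.mpr ⟨hG, hG'⟩)⟩
  choose σ η h₁ h₂ using pt
  let κ := Finset (MvPolynomial ι F)[X]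
  let U : Ultrafilter κ := Ultrafilter.of Filter.atTop
  let θ₀ : MvPolynomial ι F →+* Filter.Germ (U : Filter κ) F :=
    (Filter.Germ.coeRingHom (U : Filter κ)).comp
      (RingHom.pi fun T => (MvPolynomial.aeval (σ T) : _ →ₐ[F] F).toRingHom)
  have hu (q : nonZeroDivisors (MvPolynomial ι F)) : IsUnit (θ₀ q) := by
    refine isUnit_of_germMap_ne_zero U (f := RingHom.id F) (fun a ha => Ne.isUnit ha) _ ?_
    intro h0
    have h0' : ∀ᶠ T in (U : Filter κ), MvPolynomial.aeval (σ T) (q : MvPolynomial ι F) = 0 :=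
      Filter.Germ.coe_eq.mp h0
    have hT : ∀ᶠ T in (U : Filter (Finset (MvPolynomial ι F)[X])), {C (q : MvPolynomial ι F)} ≤ T :=
      Ultrafilter.of_le _ (Filter.eventually_ge_atTop _)
    obtain ⟨T, hT0, hT⟩ := (h0'.and hT).exists
    refine h₂ T (C q) (hT (Finset.mem_singleton_self _)) ?_ (by simpa using hT0)
    rw [← map_ne_zero_iff _ hinj, ev, map_C, aeval_C, _root_.map_ne_zero, _root_.map_ne_zero]
    exact IsLocalization.to_map_ne_zero_of_mem_nonZeroDivisors M le_rfl q.2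
  let θ₁ : M →+* Filter.Germ (U : Filter κ) F := IsLocalization.lift hu
  have hθ₁ (q : MvPolynomial ι F) : θ₁ (algebraMap _ M q) = θ₀ q := IsLocalization.lift_eq hu q
  let y : Filter.Germ (U : Filter κ) F := (η : Filter.Germ (U : Filter κ) F)
  have hy (G : (MvPolynomial ι F)[X]) : eval₂ θ₀ y G =
      ((fun T => pointEval (σ T) (η T) G : Finset (MvPolynomial ι F)[X] → F) :
        Filter.Germ (U : Filter κ) F) := by
    suffices eval₂RingHom θ₀ y = (Filter.Germ.coeRingHom (U : Filter κ)).comp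
        (RingHom.pi fun T => pointEval (F := F) (σ T) (η T)) from RingHom.congr_fun this G
    refine Polynomial.ringHom_ext (fun q => ?_) ?_
    · simp only [coe_eval₂RingHom, eval₂_C]
      refine congrArg (Filter.Germ.ofFun (l := (U : Filter κ))) (funext fun T => ?_)
      simp
    · simp only [coe_eval₂RingHom, eval₂_X]
      refine congrArg (Filter.Germ.ofFun (l := (U : Filter κ))) (funext fun T => ?_)
      simp
  have hroot : eval₂ θ₁ y m = 0 := by
    have h0 : eval₂ θ₁ y (P.map (algebraMap _ M)) = 0 := by
      rw [eval₂_map, show θ₁.comp (algebraMap _ M) = θ₀ from RingHom.ext hθ₁, hy]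
      exact congrArg (Filter.Germ.ofFun (l := (U : Filter κ))) (funext h₁)
    rw [hb, eval₂_mul, eval₂_C, hθ₁] at h0
    exact (hu ⟨b, hbm⟩).mul_right_eq_zero.mp h0
  let _ : Algebra M (Filter.Germ (U : Filter κ) F) := θ₁.toAlgebra
  let θ := pb.lift y hroot
  refine ⟨_, U, θ, fun r => ?_⟩
  refine (θ.commutes _).trans ((hθ₁ _).trans ?_)
  refine congrArg (Filter.Germ.ofFun (l := (U : Filter κ))) (funext fun T => ?_)
  simp

end GermHom

section LargeOfPlaneLarge

/-- An existential formula true in `M` is true in all sufficiently large subrings of `M`. -/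
theorem FormVal.exists_finset {α : Type u} {M : Type v} [CommRing M] {f : α → M} {n k : ℕ}
    {φ : (Language.ring[[α]]).BoundedFormula Empty k} (hφ : IsExistsN n φ) {xs : Fin k → M}
    (h : FormVal f φ xs) : ∃ T : Finset M, ∀ (A : Type w) [CommRing A] [IsDomain A] (θ : A →+* M),
      Function.Injective θ → (∀ y ∈ T, y ∈ θ.range) → ∀ (c : α → A) (ys : Fin k → A),
        θ ∘ c = f → θ ∘ ys = xs → FormVal c φ ys := by
  induction hφ with
  | qf hφ =>
    refine ⟨∅, fun A _ _ θ hθ _ c ys hc hy => ?_⟩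
    rw [formVal_iff_of_injective hθ c hφ ys, hc, hy]
    exact h
  | ex _ ih =>
    classical
    rw [formVal_ex] at h
    obtain ⟨a, ha⟩ := h
    obtain ⟨T, hT⟩ := ih ha
    refine ⟨insert a T, fun A _ _ θ hθ hA c ys hc hy => ?_⟩
    obtain ⟨b, rfl⟩ := hA a (Finset.mem_insert_self a T)
    rw [formVal_ex]
    refine ⟨b, hT A θ hθ (fun y hy => hA y (Finset.mem_insert_of_mem hy)) c _ hc ?_⟩
    rw [Fin.comp_snoc, hy]

theorem RealizeRing.exists_finset {α : Type u} {M : Type v} [CommRing M] {f : α → M} {n : ℕ}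
    {φ : (Language.ring[[α]]).Sentence} (hφ : IsExistsN n φ)
    (h : RealizeRing M f φ) : ∃ T : Finset M, ∀ (A : Type w) [CommRing A] [IsDomain A]
      (θ : A →+* M), Function.Injective θ → (∀ y ∈ T, y ∈ θ.range) → ∀ c : α → A,
        θ ∘ c = f → RealizeRing A c φ := by
  rw [realizeRing_iff_formVal] at h
  obtain ⟨T, hT⟩ := h.exists_finset.{u, v, w} hφ
  refine ⟨T, fun A _ _ θ hθ hA c hc => ?_⟩
  rw [realizeRing_iff_formVal]
  exact hT A θ hθ hA c _ hc (Subsingleton.elim _ _)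

open scoped IntermediateField.algebraAdjoinAdjoin in
theorem exists_sepTransBasis_mem {F E : Type*} [Field F] [Field E] [Algebra F E]
    [Algebra.EssFiniteType F E] (h : HasSepTransBasis F E) (R : Set E)
    (hR : ∀ a, a ∈ R ∨ a⁻¹ ∈ R) :
    ∃ (s : Set E) (x : s → E) (pb : PowerBasis (IntermediateField.adjoin F (Set.range x)) E),
      AlgebraicIndependent F x ∧ (∀ i, x i ∈ R) ∧ pb.gen ∈ R ∧
      IsSeparable (IntermediateField.adjoin F (Set.range x)) pb.gen := by
  classical
  obtain ⟨s, hs, hsep⟩ := h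
  let x : s → E := fun i => if (i : E) ∈ R then (i : E) else (i : E)⁻¹
  have hx : IntermediateField.adjoin F (Set.range x) = IntermediateField.adjoin F s := by
    apply le_antisymm <;> rw [IntermediateField.adjoin_le_iff]
    · rintro _ ⟨i, rfl⟩
      have := IntermediateField.subset_adjoin F s i.2
      dsimp only [x]
      split_ifs
      · exact this
      · exact inv_mem this
    · intro i hi
      have : x ⟨i, hi⟩ ∈ IntermediateField.adjoin F (Set.range x) :=
        IntermediateField.subset_adjoin F _ ⟨_, rfl⟩
      dsimp only [x] at this
      split_ifs at this
      · exact this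
      · simpa using inv_mem this
  rw [← hx] at hsep
  let M := IntermediateField.adjoin F (Set.range x)
  have : Algebra.EssFiniteType M E := .of_comp F M E
  have := finiteDimensional_of_isSeparable_of_essFiniteType M E
  have : Algebra.IsAlgebraic (Algebra.adjoin F (Set.range x)) E :=
    (IsFractionRing.comap_isAlgebraic_iff
      (K := IntermediateField.adjoin F (Set.range x))).mpr inferInstance
  have hxi : IsTranscendenceBasis F x :=
    Algebra.IsAlgebraic.isTranscendenceBasis_of_le_trdeg F x (trdeg_lt_aleph0 F E)
      hs.cardinalMk_le_trdeg
  obtain ⟨β, hβ⟩ := Field.exists_primitive_element M E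
  let β' := if β ∈ R then β else β⁻¹
  have hβ' : IntermediateField.adjoin M {β'} = ⊤ := by
    rw [eq_top_iff, ← hβ, IntermediateField.adjoin_le_iff, Set.singleton_subset_iff]
    dsimp only [β']
    split_ifs
    · exact IntermediateField.mem_adjoin_simple_self M β
    · simpa using inv_mem (IntermediateField.mem_adjoin_simple_self M β⁻¹)
  have hβint : IsIntegral M β' := Algebra.IsIntegral.isIntegral β'
  refine ⟨s, x, PowerBasis.ofAdjoinEqTop hβint ?_, hxi.1, fun i => ?_, ?_,
    Algebra.IsSeparable.isSeparable M _⟩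
  · rw [← IntermediateField.adjoin_simple_toSubalgebra_of_isAlgebraic hβint.isAlgebraic, hβ',
      IntermediateField.top_toSubalgebra]
  · dsimp only [x]
    split_ifs with hi
    · exact hi
    · exact (hR _).resolve_left hi
  · rw [PowerBasis.ofAdjoinEqTop_gen]
    dsimp only [β']
    split_ifs with hi
    · exact hi
    · exact (hR _).resolve_left hi

theorem PlaneLarge.exists_germ_hom_of_hasSepTransBasis {F E : Type u} [Field F] [Field E]
    [Algebra F E] [Algebra.EssFiniteType F E] (hF : PlaneLarge F) (h : HasSepTransBasis F E)
    (j : E →+* LaurentSeries F)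
    (hj : ∀ r, j (algebraMap F E r) = algebraMap F (LaurentSeries F) r) :
    ∃ (κ : Type u) (U : Ultrafilter κ) (θ : E →+* Filter.Germ (U : Filter κ) F), ∀ r : F,
      θ (algebraMap F E r) = germDiag U F r := by
  obtain ⟨s, x, pb, hx, hxR, ⟨α, hα⟩, hsep⟩ := exists_sepTransBasis_mem h
    {a | j a ∈ Set.range (algebraMap (PowerSeries F) (LaurentSeries F))} (fun a => by
      have := ValuationRing.isInteger_or_isInteger (PowerSeries F) (j a)
      rwa [← map_inv₀] at this)
  choose ξ hξ using hxR
  let M := IntermediateField.adjoin F (Set.range x)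
  let _ : Algebra (MvPolynomial s F) M :=
    (hx.aevalEquivField.toRingEquiv.toRingHom.comp (algebraMap (MvPolynomial s F) _)).toAlgebra
  let e : FractionRing (MvPolynomial s F) ≃ₐ[MvPolynomial s F] M :=
    { hx.aevalEquivField.toRingEquiv with commutes' := fun _ => rfl }
  have : IsFractionRing (MvPolynomial s F) M := IsLocalization.isLocalization_of_algEquiv _ e
  have he (q : MvPolynomial s F) : algebraMap M E (algebraMap _ M q) = MvPolynomial.aeval x q :=
    hx.aevalEquivField_algebraMap_apply_coe q
  obtain ⟨κ, U, θ, hθ⟩ := hF.exists_germ_hom pb hsep ξ α j (fun q => by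
    rw [he]
    suffices j.comp (MvPolynomial.aeval x : _ →ₐ[F] E).toRingHom =
        (algebraMap (PowerSeries F) (LaurentSeries F)).comp
          (MvPolynomial.aeval ξ : _ →ₐ[F] PowerSeries F).toRingHom from RingHom.congr_fun this q
    refine MvPolynomial.ringHom_ext (fun r => ?_) (fun i => ?_)
    · simp only [RingHom.comp_apply, AlgHom.toRingHom_eq_coe, RingHom.coe_coe,
        MvPolynomial.aeval_C, hj]
      rfl
    · simpa using (hξ i).symm) hα.symm
  refine ⟨κ, U, θ, fun r => (hθ r).symm ▸ congrArg θ ?_⟩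
  rw [he, MvPolynomial.aeval_C]

theorem PlaneLarge.largeField {F : Type u} [Field F] (hF : PlaneLarge F) : LargeField.{u} F := by
  rintro φ ⟨n, hφ⟩ h
  obtain ⟨T, hT⟩ := h.exists_finset.{u, u, u} hφ
  have hsep := isSepExtHom_laurentSeries F
  let _ : Algebra F (LaurentSeries F) := (algebraMap F (LaurentSeries F)).toAlgebra
  let E := IntermediateField.adjoin F (T : Set (LaurentSeries F))
  have : Algebra.EssFiniteType F E :=
    IntermediateField.essFiniteType_iff.mpr (IntermediateField.fg_adjoin_finset T)
  obtain ⟨κ, U, θ, hθ⟩ := hF.exists_germ_hom_of_hasSepTransBasis (hsep T)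
    (algebraMap E (LaurentSeries F)) (fun _ => rfl)
  have hE : RealizeRing E (algebraMap F E) φ := hT E (algebraMap E (LaurentSeries F))
    (algebraMap E (LaurentSeries F)).injective
    (fun y hy => ⟨⟨y, IntermediateField.subset_adjoin F _ hy⟩, rfl⟩) _ rfl
  have h' := hE.map_of_injective θ.injective _ hφ
  rw [show θ ∘ algebraMap F E = germDiag U F ∘ id from funext hθ] at h'
  exact h'.of_germ U _ hφ

end LargeOfPlaneLarge

section Tower

/-- The transition maps of a sequence of rings. -/
def natTransition {G : ℕ → Type u} [∀ n, CommRing (G n)] (s : ∀ n, G n →+* G (n + 1))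
    (i j : ℕ) (h : i ≤ j) : G i →+* G j :=
  Nat.leRec (motive := fun j _ => G i →+* G j) (RingHom.id _) (fun k _ r => (s k).comp r) h

theorem natTransition_self {G : ℕ → Type u} [∀ n, CommRing (G n)] (s : ∀ n, G n →+* G (n + 1))
    (i : ℕ) : natTransition s i i le_rfl = RingHom.id _ :=
  Nat.leRec_self _ _

theorem natTransition_succ {G : ℕ → Type u} [∀ n, CommRing (G n)] (s : ∀ n, G n →+* G (n + 1))
    {i j : ℕ} (h : i ≤ j) :
    natTransition s i (j + 1) (h.trans j.le_succ) = (s j).comp (natTransition s i j h) :=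
  Nat.leRec_succ _ _ h

theorem exists_nat_colimit (G : ℕ → Type u) [∀ n, CommRing (G n)] (s : ∀ n, G n →+* G (n + 1))
    (hs : ∀ n, Function.Injective (s n)) :
    ∃ (L : Type u) (_ : CommRing L) (ι : ∀ n, G n →+* L),
      (∀ n, Function.Injective (ι n)) ∧ (∀ n x, ι (n + 1) (s n x) = ι n x) ∧
      (∀ T : Finset L, ∃ n, ∀ y ∈ T, y ∈ (ι n).range) ∧
      ∀ (P : Type u) [CommRing P] (g : ∀ n, G n →+* P), (∀ n x, g (n + 1) (s n x) = g n x) →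
        ∃ h : L →+* P, ∀ n x, h (ι n x) = g n x := by
  classical
  have : DirectedSystem G fun i j h => natTransition s i j h :=
    { map_self := fun i x => by rw [natTransition_self]; rfl
      map_map := fun k j i hij hjk x => by
        induction k, hjk using Nat.le_induction with
        | base => rw [natTransition_self]; rfl
        | succ k hjk ih =>
          rw [natTransition_succ s hjk, natTransition_succ s (hij.trans hjk)]
          exact congrArg (s k) ih }
  have hinj : ∀ i j h, Function.Injective (natTransition s i j h) := by
    intro i j h
    induction j, h using Nat.le_induction with
    | base => rw [natTransition_self]; exact fun _ _ h => h
    | succ j h ih => rw [natTransition_succ s h]; exact (hs j).comp ih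
  have hstep : ∀ n x, Ring.DirectLimit.of G (fun i j h => natTransition s i j h) (n + 1) (s n x) =
      Ring.DirectLimit.of G (fun i j h => natTransition s i j h) n x := by
    intro n x
    rw [← Ring.DirectLimit.of_f (f := fun i j h => natTransition s i j h) n.le_succ x,
      natTransition_succ s le_rfl, natTransition_self]
    rfl
  refine ⟨Ring.DirectLimit G fun i j h => natTransition s i j h, inferInstance,
    fun n => Ring.DirectLimit.of _ _ n, fun n => Ring.DirectLimit.of_injective _ hinj n, hstep,
    fun T => ?_, fun P _ g hg => ?_⟩
  · induction T using Finset.induction_on with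
    | empty => exact ⟨0, fun y hy => absurd hy (Finset.notMem_empty y)⟩
    | insert a T _ ih =>
      obtain ⟨n, hn⟩ := ih
      obtain ⟨m, z, rfl⟩ := Ring.DirectLimit.exists_of a
      refine ⟨max m n, fun y hy => ?_⟩
      rcases Finset.mem_insert.mp hy with rfl | hy
      · exact ⟨_, Ring.DirectLimit.of_f (f := fun i j h => natTransition s i j h)
          (le_max_left m n) z⟩
      · obtain ⟨z', rfl⟩ := hn y hy
        exact ⟨_, Ring.DirectLimit.of_f (f := fun i j h => natTransition s i j h)
          (le_max_right m n) z'⟩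
  · refine ⟨Ring.DirectLimit.lift _ _ P g fun i j h x => ?_, fun n x => Ring.DirectLimit.lift_of ..⟩
    induction j, h using Nat.le_induction with
    | base => rw [natTransition_self]; rfl
    | succ j h ih =>
      rw [natTransition_succ s h]
      exact (hg j _).trans ih

/-- A valuation domain `O` with a henselian residue map `π : O → F` onto a field,
and a field of constants `a : L → O` over which the residue field is separable. -/
structure SectionData where
  O : Type u
  F : Type u
  L : Type u
  [ringO : CommRing O]
  [fieldF : Field F]
  [fieldL : Field L]
  [domain : IsDomain O]
  π : O →+* F
  a : L →+* O
  dvd_total : ∀ x y : O, x ∣ y ∨ y ∣ x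
  surj : Function.Surjective π
  isUnit : ∀ y, π y ≠ 0 → IsUnit y
  hens : HenselLift π
  sep : IsSepExtHom (π.comp a)
  large : PlaneLarge F

namespace SectionData

attribute [instance] ringO fieldF fieldL domain

variable (S : SectionData.{u})

/-- The ultrafilter used for the next stage of the tower. -/
noncomputable def ultra : Ultrafilter (Finset S.F) :=
  Ultrafilter.of Filter.atTop

/-- A lift of the residue field to the ultrapower of `O`. -/
noncomputable def lift : S.F →+* Filter.Germ (S.ultra : Filter (Finset S.F)) S.O :=
  (exists_germ_section S.surj S.isUnit S.hens S.a S.sep S.ultra (Ultrafilter.of_le _)).choose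

theorem germMap_comp_lift : (germMap S.ultra S.π).comp S.lift = germDiag S.ultra S.F :=
  (exists_germ_section S.surj S.isUnit S.hens S.a S.sep S.ultra
    (Ultrafilter.of_le _)).choose_spec.1

theorem lift_comp : S.lift.comp (S.π.comp S.a) = (germDiag S.ultra S.O).comp S.a :=
  (exists_germ_section S.surj S.isUnit S.hens S.a S.sep S.ultra
    (Ultrafilter.of_le _)).choose_spec.2

/-- The next stage: ultrapowers, with the old residue field as field of constants. -/
noncomputable def next : SectionData.{u} where
  O := Filter.Germ (S.ultra : Filter (Finset S.F)) S.O
  F := Filter.Germ (S.ultra : Filter (Finset S.F)) S.F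
  L := S.F
  domain := isDomain_germ S.ultra S.O
  π := germMap S.ultra S.π
  a := S.lift
  dvd_total := germ_dvd_total S.ultra S.dvd_total
  surj := germMap_surjective S.ultra S.surj
  isUnit := isUnit_of_germMap_ne_zero S.ultra S.isUnit
  hens := HenselLift.germMap S.ultra S.hens
  sep := by
    rw [germMap_comp_lift]
    exact isSepExtHom_germDiag S.ultra S.F
  large := S.large.germ S.ultra

/-- The tower of iterated ultrapowers. -/
noncomputable def tower : ℕ → SectionData.{u}
  | 0 => S
  | n + 1 => (tower n).next

theorem exists_limit : ∃ (O F : Type u) (_ : CommRing O) (_ : CommRing F) (π : O →+* F)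
    (s : F →+* O) (j : S.O →+* O) (i : ∀ n, (S.tower n).F →+* F),
    IsDomain O ∧ (∀ x y : O, x ∣ y ∨ y ∣ x) ∧ (∀ y, π y ≠ 0 → IsUnit y) ∧
    π.comp s = RingHom.id F ∧ Function.Injective j ∧
    s.comp ((i 0).comp (S.π.comp S.a)) = j.comp S.a ∧
    (∀ n, Function.Injective (i n)) ∧
    (∀ n x, i (n + 1) (germDiag (S.tower n).ultra _ x) = i n x) ∧
    ∀ T : Finset F, ∃ n, ∀ y ∈ T, y ∈ (i n).range := by
  obtain ⟨O, _, j, hj, hjs, hjT, hjl⟩ := exists_nat_colimit (fun n => (S.tower n).O)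
    (fun n => germDiag (S.tower n).ultra (S.tower n).O) (fun n => germDiag_injective _ _)
  obtain ⟨F, _, i, hi, his, hiT, hil⟩ := exists_nat_colimit (fun n => (S.tower n).F)
    (fun n => germDiag (S.tower n).ultra (S.tower n).F) (fun n => germDiag_injective _ _)
  obtain ⟨π, hπ⟩ := hjl F (fun n => (i n).comp (S.tower n).π) fun n x => his n ((S.tower n).π x)
  obtain ⟨s, hs⟩ := hil O (fun n => (j (n + 1)).comp (S.tower n).lift) fun n x => by
    have h : (S.tower (n + 1)).π ((S.tower (n + 1)).a x) = germDiag (S.tower n).ultra _ x :=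
      RingHom.congr_fun (S.tower n).germMap_comp_lift x
    have h' : (S.tower (n + 1)).lift (germDiag (S.tower n).ultra _ x) =
        germDiag (S.tower (n + 1)).ultra _ ((S.tower (n + 1)).a x) :=
      (congrArg (S.tower (n + 1)).lift h).symm.trans
        (RingHom.congr_fun (S.tower (n + 1)).lift_comp x)
    exact (congrArg (j (n + 2)) h').trans (hjs (n + 1) _)
  classical
  have hj2 : ∀ x y : O, ∃ n x' y', j n x' = x ∧ j n y' = y := by
    intro x y
    obtain ⟨n, hn⟩ := hjT {x, y}
    obtain ⟨x', hx⟩ := hn x (by simp)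
    obtain ⟨y', hy⟩ := hn y (by simp)
    exact ⟨n, x', y', hx, hy⟩
  refine ⟨O, F, inferInstance, inferInstance, π, s, j 0, i, ?_, ?_, ?_, ?_, hj 0, ?_, hi, his, hiT⟩
  · have : Nontrivial O := (hj 0).nontrivial
    have : NoZeroDivisors O := ⟨fun {x y} h => by
      obtain ⟨n, x, y, rfl, rfl⟩ := hj2 x y
      rw [← map_mul, map_eq_zero_iff _ (hj n), mul_eq_zero] at h
      exact h.imp (fun h => by rw [h, map_zero]) (fun h => by rw [h, map_zero])⟩
    exact NoZeroDivisors.to_isDomain O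
  · intro x y
    obtain ⟨n, x, y, rfl, rfl⟩ := hj2 x y
    exact ((S.tower n).dvd_total x y).imp (map_dvd (j n)) (map_dvd (j n))
  · intro y hy
    obtain ⟨n, -, y, -, rfl⟩ := hj2 0 y
    refine ((S.tower n).isUnit y fun h => hy ?_).map (j n)
    rw [hπ, RingHom.comp_apply, h, map_zero]
  · refine RingHom.ext fun y => ?_
    obtain ⟨n, hn⟩ := hiT {y}
    obtain ⟨y, rfl⟩ := hn _ (Finset.mem_singleton_self _)
    have h : (S.tower (n + 1)).π ((S.tower n).lift y) = germDiag (S.tower n).ultra _ y :=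
      RingHom.congr_fun (S.tower n).germMap_comp_lift y
    exact (congrArg π (hs n y)).trans
      ((hπ (n + 1) _).trans ((congrArg (i (n + 1)) h).trans (his n y)))
  · refine RingHom.ext fun c => ?_
    have h1 := RingHom.congr_fun S.lift_comp c
    refine (hs 0 _).trans ((congrArg (j 1) h1).trans ?_)
    exact hjs 0 _

end SectionData

end Tower

section Transfer

namespace SectionData

variable (S : SectionData.{u})

theorem exists_tower_realizeRing {α : Type u} {n : ℕ} {φ : (Language.ring[[α]]).Sentence}
    (hφ : IsExistsN n φ) {F : Type u} [CommRing F] (i : ∀ n, (S.tower n).F →+* F)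
    (hi : ∀ n x, i (n + 1) (germDiag (S.tower n).ultra _ x) = i n x) (c : α → S.F) (m : ℕ) :
    ∃ d : α → (S.tower m).F, (∀ a, i m (d a) = i 0 (c a)) ∧
      (RealizeRing (S.tower m).F d φ → RealizeRing S.F c φ) := by
  induction m with
  | zero => exact ⟨c, fun _ => rfl, id⟩
  | succ m ih =>
    obtain ⟨d, hd, h⟩ := ih
    exact ⟨germDiag (S.tower m).ultra _ ∘ d, fun a => (hi m (d a)).trans (hd a),
      fun h' => h (RealizeRing.of_germ (S.tower m).ultra d hφ h')⟩

/-- Existential sentences over the constants pass from the residue field to every field receiving a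
homomorphism from the valuation ring. -/
theorem realizeRing_of_residue {α : Type u} {n : ℕ} {φ : (Language.ring[[α]]).Sentence}
    (hφ : IsExistsN n φ) {K : Type u} [Field K] (ι : S.O →+* K)
    (c : α → S.L) (h : RealizeRing S.F (S.π ∘ S.a ∘ c) φ) : RealizeRing K (ι ∘ S.a ∘ c) φ := by
  let ζ := (germMap S.ultra ι).comp S.lift
  have h' := h.map_of_injective (θ := ζ) ζ.injective _ hφ
  refine RealizeRing.of_germ S.ultra _ hφ ?_
  rw [show germDiag S.ultra K ∘ ι ∘ S.a ∘ c = ζ ∘ S.π ∘ S.a ∘ c from funext fun x =>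
    congrArg (germMap S.ultra ι) (RingHom.congr_fun S.lift_comp (c x)).symm]
  exact h'

/-- Under `R4N n`, `∃_n`-sentences over the constants pass from the fraction field of the valuation
ring to the residue field. -/
theorem realizeRing_residue {n : ℕ} (hR4 : R4N.{u} n) {α : Type u}
    {φ : (Language.ring[[α]]).Sentence} (hφ : IsExistsN n φ) {K : Type u} [Field K]
    [Algebra S.O K] [IsFractionRing S.O K] (c : α → S.L)
    (h : RealizeRing K (algebraMap S.O K ∘ S.a ∘ c) φ) : RealizeRing S.F (S.π ∘ S.a ∘ c) φ := by
  obtain ⟨O, F, _, _, π, s, j, i, _, hO, hloc, hπs, hj, hc, hi, hi', hiT⟩ := S.exists_limit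
  have hπs' : ∀ y, π (s y) = y := RingHom.congr_fun hπs
  have hs : Function.Injective s := Function.LeftInverse.injective hπs'
  have : Nontrivial F := (hi 0).nontrivial
  have : ValuationRing O := ValuationRing.iff_dvd_total.mpr ⟨hO⟩
  let E := FractionRing O
  let w := ValuationRing.valuation O E
  have hE : Function.Injective (algebraMap O E) := IsFractionRing.injective O E
  let σ : F →+* E := (algebraMap O E).comp s
  let F' : Subfield E :=
    { σ.range with
      inv_mem' := by
        rintro _ ⟨y, rfl⟩
        obtain ⟨m, hm⟩ := hiT {y}
        obtain ⟨z, rfl⟩ := hm y (Finset.mem_singleton_self y)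
        exact ⟨i m z⁻¹, map_inv₀ (σ.comp (i m)) z⟩ }
  let σ' : F →+* F' := σ.codRestrict F' fun y => ⟨y, rfl⟩
  have hσ' : ∀ y, (σ' y : E) = σ y := fun _ => rfl
  have hσinj : Function.Injective σ' := fun x y hxy => hs (hE (congrArg Subtype.val hxy))
  have hσsurj : ∀ T : Finset F', ∃ m, ∀ y ∈ T, y ∈ (σ'.comp (i m)).range := by
    classical
    intro T
    have hsurj : Function.Surjective σ' := by
      rintro ⟨_, y, rfl⟩
      exact ⟨y, rfl⟩
    choose r hr using hsurj
    obtain ⟨m, hm⟩ := hiT (T.image r)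
    refine ⟨m, fun y hy => ?_⟩
    obtain ⟨z, hz⟩ := hm (r y) (Finset.mem_image_of_mem r hy)
    exact ⟨z, by rw [RingHom.comp_apply, hz, hr]⟩
  have hlarge : LargeField.{u} F' := by
    refine PlaneLarge.largeField (PlaneLarge.of_exhaust.{u} fun T => ?_)
    obtain ⟨m, hm⟩ := hσsurj T
    exact ⟨(S.tower m).F, inferInstance, σ'.comp (i m), (S.tower m).large,
      hσinj.comp (hi m), hm⟩
  have hwO : ∀ y : O, w (algebraMap O E y) ≤ 1 := fun y =>
    (ValuationRing.mem_integer_iff O E _).mpr ⟨y, rfl⟩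
  have hwF : ∀ y : F', (y : E) ≠ 0 → w y = 1 := by
    have hle : ∀ y : F', w y ≤ 1 := by
      rintro ⟨_, y, rfl⟩
      exact hwO _
    intro y hy
    refine le_antisymm (hle y) ?_
    have h1 := hle y⁻¹
    rw [Subfield.coe_inv, map_inv₀] at h1
    exact (inv_le_one₀ (zero_lt_iff.mpr ((Valuation.ne_zero_iff w).mpr hy))).mp h1
  have hwres : ∀ y : E, w y ≤ 1 → ∃ x : F', w (y - x) < 1 := by
    intro y hy
    obtain ⟨o, rfl⟩ := (ValuationRing.mem_integer_iff O E _).mp hy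
    refine ⟨σ' (π o), ?_⟩
    rw [hσ', RingHom.comp_apply, ← map_sub]
    have h0 : π (o - s (π o)) = 0 := by rw [map_sub, hπs', sub_self]
    refine lt_of_le_of_ne (hwO _) fun h1 => ?_
    have h2 : w (algebraMap O E (o - s (π o)))⁻¹ ≤ 1 := by rw [map_inv₀, h1, inv_one]
    obtain ⟨b, hb⟩ := (ValuationRing.mem_integer_iff O E _).mp h2
    have h3 : algebraMap O E (o - s (π o)) ≠ 0 := fun h => by
      rw [h, map_zero] at h1
      exact zero_ne_one h1
    have h4 : (o - s (π o)) * b = 1 := hE (by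
      rw [map_mul, hb, mul_inv_cancel₀ h3, map_one])
    have h5 := congrArg π h4
    rw [map_mul, h0, zero_mul, map_one] at h5
    exact zero_ne_one h5
  let e : α → F' := fun x => σ' (i 0 (S.π (S.a (c x))))
  obtain ⟨ψ, hψ, hψ'⟩ := exists_isExistsN_realizeRing_iff.{u} e hφ
  let θ : K →+* E := IsFractionRing.lift (A := S.O) (g := (algebraMap O E).comp j) (hE.comp hj)
  have hθ : θ ∘ algebraMap S.O K ∘ S.a ∘ c = (fun y : F' => (y : E)) ∘ e := funext fun x =>
    (IsFractionRing.lift_algebraMap _ _).trans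
      (congrArg (algebraMap O E) (RingHom.congr_fun hc (c x)).symm)
  have h1 := h.map_of_injective (θ := θ) θ.injective _ hφ
  rw [hθ] at h1
  have h2 := (hψ' F' id).mp (hR4 E _ w F' hlarge hwF hwres ψ hψ ((hψ' E _).mpr h1))
  obtain ⟨T, hT⟩ := h2.exists_finset.{u, u, u} hφ
  obtain ⟨m, hm⟩ := hσsurj T
  obtain ⟨d, hd, hd'⟩ := S.exists_tower_realizeRing hφ i hi' (S.π ∘ S.a ∘ c) m
  exact hd' (hT _ (σ'.comp (i m)) (hσinj.comp (hi m)) hm d (funext fun x => congrArg σ' (hd x)))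

end SectionData

end Transfer

/-- Proposition `prop:same_E4` of the paper.
Let `(K, v)` be an equicharacteristic henselian valued field with `Kv` large, `v` trivial on a
subfield `C` of `K`; identify `C` with its image in `Kv` under the residue map (here realized
by the embedding `g : C →+* Kv`), and assume `Kv/C` is separable.  If `(R4_n)` holds, then
`Th_{∃_n}(K, C) = Th_{∃_n}(Kv, C)`. -/
theorem statement5 (n : ℕ)
    (K : Type u) [Field K]
    (Γ : Type u) [LinearOrderedCommGroupWithZero Γ] (v : Valuation K Γ)
    (hhens : IsHenselian v)
    (hequichar : ringChar K = ringChar (ResF v))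
    (hlarge : LargeField.{u} (ResF v))
    -- `v` is trivial on the subfield `C`
    (C : Subfield K) (htriv : ∀ c : C, (c : K) ≠ 0 → v c = 1)
    (hC : ∀ c : C, (c : K) ∈ v.valuationSubring)
    -- the identification of `C` with its image in `Kv` under the residue map
    (g : C →+* ResF v) (hg : ∀ c : C, g c = resMap v ⟨c, hC c⟩)
    -- `Kv/C` is separable
    (hsep : IsSepExtHom g)
    -- `(R4_n)`
    (hR4 : R4N.{u} n) :
    -- `Th_{∃_n}(K, C) = Th_{∃_n}(Kv, C)`
    ThRingSub (fun {k} φ => IsExistsN n φ) K ((↑) : C → K) (ResF v) g ∧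
    ThRingSub (fun {k} φ => IsExistsN n φ) (ResF v) g K ((↑) : C → K) := by
  let a : C →+* v.valuationSubring := C.subtype.codRestrict v.valuationSubring hC
  have ha : (resMap v).comp a = g := RingHom.ext fun c => (hg c).symm
  have hker : ∀ y, resMap v y ≠ 0 ↔ IsUnit y := fun y => IsLocalRing.residue_ne_zero_iff_isUnit y
  let S : SectionData.{u} :=
    { O := v.valuationSubring
      F := ResF v
      L := C
      π := resMap v
      a := a
      dvd_total := (ValuationRing.iff_dvd_total.mp inferInstance).total
      surj := IsLocalRing.residue_surjective
      isUnit := fun y => (hker y).mp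
      hens := fun f hf x h₀ h₁ => by
        obtain ⟨y, hy, hyx⟩ := hhens.is_henselian f hf x
          ((IsLocalRing.residue_eq_zero_iff _).mp h₀) ((hker _).mp h₁)
        refine ⟨y, hy, ?_⟩
        rw [← sub_eq_zero, ← map_sub]
        exact (IsLocalRing.residue_eq_zero_iff _).mpr hyx
      sep := ha.symm ▸ hsep
      large := hlarge.planeLarge }
  have hg' : (g : C → ResF v) = S.π ∘ S.a ∘ id := funext hg
  rw [hg']
  refine ⟨thRingSub_of_forall fun φ hφ h => ?_, thRingSub_of_forall fun φ hφ h => ?_⟩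
  · have : IsFractionRing S.O K := inferInstanceAs (IsFractionRing v.valuationSubring K)
    exact S.realizeRing_residue hR4 hφ (K := K) id h
  · exact S.realizeRing_of_residue hφ (algebraMap v.valuationSubring K) id h

end Paper
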